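/- arXiv:1603.06530 — 6 statements merged into one kernel-verified Lean document; each statement's English description precedes it below -/
import Mathlib

section
/- Let f ∈ ℂ[z₁,…,zₙ] be a nondegenerate quasi-homogeneous polynomial with weights q₁,…,qₙ. Then each weight satisfies q_i ≤ 1/2, and the weights are unique: if f is also quasi-homogeneous with weights q₁',…,qₙ', then q_i' = q_i for all i = 1,…,n. -/
open MvPolynomial

/-- `f ∈ ℂ[z₁,…,zₙ]` is quasi-homogeneous of degree `d` with integer weights `k i`
(so the rational weights are `q i = k i / d`):
`f (λ^{k₁} z₁, …, λ^{kₙ} zₙ) = λ^d • f z` for all `λ` and `z`. -/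
def IsQuasiHomogeneous {n : ℕ} (f : MvPolynomial (Fin n) ℂ) (d : ℕ) (k : Fin n → ℕ) : Prop :=
  ∀ (lam : ℂ) (z : Fin n → ℂ),
    eval (fun i => lam ^ k i * z i) f = lam ^ d * eval z f

/-- `f` is nondegenerate: it contains no monomial `z_i z_j` with `i ≠ j`, and the origin is
an isolated critical point of `f` (the only common zero of the `∂f/∂z_i` near `0`). -/
def Nondegenerate {n : ℕ} (f : MvPolynomial (Fin n) ℂ) : Prop :=
  (∀ i j : Fin n, i ≠ j →
    coeff (Finsupp.single i 1 + Finsupp.single j 1) f = 0) ∧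
  (∃ ε : ℝ, 0 < ε ∧ ∀ z : Fin n → ℂ, (∀ i, ‖z i‖ < ε) →
    (∀ i, eval z (pderiv i f) = 0) → z = 0)

theorem qh_degree {n : ℕ} {f : MvPolynomial (Fin n) ℂ} {d : ℕ} {k : Fin n → ℕ}
    (h : IsQuasiHomogeneous f d k) (a : Fin n →₀ ℕ) (ha : coeff a f ≠ 0) :
    ∑ i, k i * a i = d := by
  have key : (∑ b ∈ f.support, monomial b ((2:ℂ) ^ (∑ i, k i * b i) * coeff b f))
      = C ((2:ℂ) ^ d) * f := by
    apply MvPolynomial.funext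
    intro z
    rw [map_mul, eval_C, ← h 2 z, map_sum, eval_eq' _ f]
    apply Finset.sum_congr rfl
    intro b _
    rw [eval_monomial, Finsupp.prod_fintype _ _ (by simp)]
    simp only [mul_pow, Finset.prod_mul_distrib, ← pow_mul]
    rw [Finset.prod_pow_eq_pow_sum]
    ring
  have h2 := congrArg (coeff a) key
  rw [coeff_C_mul, coeff_sum] at h2
  simp only [coeff_monomial] at h2
  rw [Finset.sum_ite_eq' , if_pos (by simpa using ha)] at h2
  have h3 := mul_right_cancel₀ ha h2
  have h4 : (2:ℕ) ^ (∑ i, k i * a i) = 2 ^ d := by exact_mod_cast h3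
  exact Nat.pow_right_injective (le_refl 2) h4

theorem exists_mono {n : ℕ} {f : MvPolynomial (Fin n) ℂ} (hnd : Nondegenerate f) (i : Fin n) :
    ∃ (m : ℕ) (j : Fin n), coeff (Finsupp.single i m + Finsupp.single j 1) f ≠ 0 := by
  by_contra! hc
  obtain ⟨-, ε, hε, h⟩ := hnd
  have hz := h (Pi.single i ((ε / 2 : ℝ) : ℂ)) ?_ ?_
  · have := congrFun hz i
    simp at this
    exact hε.ne' this
  · intro j
    by_cases hj : j = i
    · subst hj
      simp only [Pi.single_eq_same, Complex.norm_real, Real.norm_eq_abs]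
      rw [abs_of_pos (by positivity)]
      linarith
    · simpa [hj] using hε
  · intro j
    rw [eval_eq']
    apply Finset.sum_eq_zero
    intro b _
    by_cases hb : b = Finsupp.single i (b i)
    · rw [coeff_pderiv, hb, hc]
      simp
    · obtain ⟨l, hl⟩ : ∃ l, b l ≠ Finsupp.single i (b i) l := by
        by_contra! hh
        exact hb (Finsupp.ext hh)
      have hli : l ≠ i := by
        rintro rfl
        simp at hl
      rw [Finsupp.single_eq_of_ne hli] at hl
      rw [Finset.prod_eq_zero (Finset.mem_univ l), mul_zero]
      rw [Pi.single_eq_of_ne hli, zero_pow hl]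

theorem qh_eq {n : ℕ} {f : MvPolynomial (Fin n) ℂ} {d : ℕ} {k : Fin n → ℕ}
    (h : IsQuasiHomogeneous f d k) {i j : Fin n} {m : ℕ}
    (ha : coeff (Finsupp.single i m + Finsupp.single j 1) f ≠ 0) :
    k i * m + k j = d := by
  have := qh_degree h _ ha
  simpa [mul_add, Finset.sum_add_distrib, Finsupp.single_apply] using this

theorem exists_mono_two {n : ℕ} {f : MvPolynomial (Fin n) ℂ} (hnd : Nondegenerate f)
    {d : ℕ} {k : Fin n → ℕ} (hk1 : ∀ i, k i < d) (h : IsQuasiHomogeneous f d k) (i : Fin n) :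
    ∃ (m : ℕ) (j : Fin n), coeff (Finsupp.single i m + Finsupp.single j 1) f ≠ 0 ∧
      1 ≤ m ∧ (j ≠ i → 2 ≤ m) := by
  obtain ⟨m, j, hm⟩ := exists_mono hnd i
  have he := qh_eq h hm
  have h1 : 1 ≤ m := by
    rcases Nat.eq_zero_or_pos m with rfl | h0
    · have := hk1 j
      omega
    · exact h0
  refine ⟨m, j, hm, h1, fun hji => ?_⟩
  by_contra hlt
  obtain rfl : m = 1 := by omega
  exact hm (hnd.1 i j hji.symm)

/-- For a nondegenerate quasi-homogeneous polynomial the weights `q i = k i / d` satisfy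
`q i ≤ 1/2` and are unique. -/
theorem weights_le_half_and_unique {n : ℕ} (f : MvPolynomial (Fin n) ℂ)
    (d : ℕ) (k : Fin n → ℕ) (hd : 0 < d) (hk0 : ∀ i, 0 < k i) (hk1 : ∀ i, k i < d)
    (hQH : IsQuasiHomogeneous f d k) (hnd : Nondegenerate f) :
    (∀ i, (k i : ℚ) / d ≤ 1 / 2) ∧
    (∀ (d' : ℕ) (k' : Fin n → ℕ), 0 < d' → (∀ i, 0 < k' i) → (∀ i, k' i < d') →
      IsQuasiHomogeneous f d' k' → ∀ i, (k' i : ℚ) / d' = (k i : ℚ) / d) := by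
  refine ⟨fun i => ?_, fun d' k' hd' hk0' hk1' hQH' => ?_⟩
  · obtain ⟨m, j, hm, h1, h2⟩ := exists_mono_two hnd hk1 hQH i
    have he := qh_eq hQH hm
    have h3 : 2 * k i ≤ d := by
      by_cases hji : j = i
      · subst hji
        nlinarith [hk0 j]
      · have := h2 hji
        nlinarith [hk0 i]
    rw [div_le_div_iff₀ (by exact_mod_cast hd) (by norm_num)]
    have : (2 : ℚ) * k i ≤ d := by exact_mod_cast h3
    linarith
  · have key : ∀ i, (k' i : ℤ) * d - k i * d' = 0 := by
      intro i0
      set w : Fin n → ℤ := fun i => (k' i : ℤ) * d - k i * d' with hw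
      obtain ⟨i, -, hi⟩ := Finset.exists_max_image Finset.univ (fun i => |w i|)
        ⟨i0, Finset.mem_univ _⟩
      have hwi : w i = 0 := by
        obtain ⟨m, j, hm, h1, h2⟩ := exists_mono_two hnd hk1 hQH i
        have he : (k i : ℤ) * m + k j = d := by exact_mod_cast qh_eq hQH hm
        have he' : (k' i : ℤ) * m + k' j = d' := by exact_mod_cast qh_eq hQH' hm
        have hs : w j = - (m * w i) := by
          simp only [hw]
          linear_combination d * he' - d' * he
        by_cases hji : j = i
        · subst hji
          have : ((m : ℤ) + 1) * w j = 0 := by linear_combination hs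
          rcases mul_eq_zero.1 this with h | h
          · omega
          · exact h
        · have hm2 : (2 : ℤ) ≤ m := by exact_mod_cast h2 hji
          have hle := hi j (Finset.mem_univ _)
          simp only [hs, abs_neg, abs_mul, Nat.abs_cast] at hle
          have h0 := abs_nonneg (w i)
          have : |w i| = 0 := by nlinarith
          exact abs_eq_zero.1 this
      have := hi i0 (Finset.mem_univ _)
      simp only [hwi, abs_zero] at this
      exact abs_eq_zero.1 (le_antisymm this (abs_nonneg _))
    intro i
    rw [div_eq_div_iff (by exact_mod_cast hd'.ne') (by exact_mod_cast hd.ne')]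
    have := key i
    exact_mod_cast sub_eq_zero.1 this
end

section
/- Let f ∈ ℂ[z₁,…,zₙ] be a nondegenerate quasi-homogeneous polynomial with weights q₁,…,qₙ, and set γ_i = q_i / min_j(1−q_j) for i = 1,…,n. Then γ_i ≤ 1 for all i, and there exists a constant C > 0 (depending only on f) such that for every u = (u₁,…,uₙ) ∈ ℂⁿ and every i, |u_i| ≤ C (∑_{j=1}ⁿ |∂f/∂z_j(u)| + 1)^{γ_i}. Moreover, if q_i < 1/2 for all i, then γ_i < 1 for all i. -/
open MvPolynomial

lemma fjr_weight_pow {n : ℕ} (k : Fin n → ℕ) (lam : ℂ) (z : Fin n → ℂ) (m : Fin n →₀ ℕ) :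
    ∏ i, (lam ^ k i * z i) ^ m i = lam ^ (Finsupp.weight k m) * ∏ i, z i ^ m i := by
  rw [Finsupp.weight_eq_sum]
  simp only [mul_pow, Finset.prod_mul_distrib, ← pow_mul, Finset.prod_pow_eq_pow_sum, smul_eq_mul]
  congr 2
  exact Finset.sum_congr rfl fun i _ => mul_comm _ _

lemma fjr_wh {n : ℕ} (f : MvPolynomial (Fin n) ℂ) (d : ℕ) (k : Fin n → ℕ)
    (h : IsQuasiHomogeneous f d k) : f.IsWeightedHomogeneous k d := by
  classical
  have key : (∑ m ∈ f.support, monomial m ((2:ℂ) ^ (Finsupp.weight k m) * coeff m f))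
      = C ((2:ℂ) ^ d) * f := by
    apply MvPolynomial.funext
    intro z
    have := h 2 z
    rw [eval_mul, eval_C, ← this, map_sum, eval_eq']
    refine Finset.sum_congr rfl fun m _ => ?_
    rw [eval_monomial, fjr_weight_pow, Finsupp.prod_fintype _ _ (by simp)]
    ring
  intro m hm
  have h2 := congrArg (coeff m) key
  rw [coeff_sum, coeff_C_mul] at h2
  simp only [coeff_monomial] at h2
  rw [Finset.sum_ite_eq' , if_pos (mem_support_iff.2 hm)] at h2
  have h3 := mul_right_cancel₀ hm h2
  have h4 : (2:ℕ) ^ (Finsupp.weight k m) = 2 ^ d := by exact_mod_cast h3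
  exact Nat.pow_right_injective le_rfl h4

lemma fjr_eval {n : ℕ} (g : MvPolynomial (Fin n) ℂ) (e : ℕ) (k : Fin n → ℕ)
    (h : g.IsWeightedHomogeneous k e) (lam : ℂ) (z : Fin n → ℂ) :
    eval (fun i => lam ^ k i * z i) g = lam ^ e * eval z g := by
  rw [eval_eq', eval_eq', Finset.mul_sum]
  refine Finset.sum_congr rfl fun m hm => ?_
  rw [fjr_weight_pow, h (mem_support_iff.1 hm)]
  ring

lemma fjr_half {n : ℕ} (f : MvPolynomial (Fin n) ℂ) (d : ℕ) (k : Fin n → ℕ)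
    (hk1 : ∀ i, k i < d) (hw : f.IsWeightedHomogeneous k d) (hnd : Nondegenerate f)
    (i : Fin n) : 2 * k i ≤ d := by
  classical
  obtain ⟨h1, ε, hε, h2⟩ := hnd
  let z : Fin n → ℂ := Pi.single i ((ε / 2 : ℝ) : ℂ)
  have hz : z ≠ 0 := by
    intro h
    have := congrFun h i
    simp [z] at this
    exact hε.ne' this
  have hz2 : ∀ j, ‖z j‖ < ε := by
    intro j
    by_cases hj : j = i
    · subst hj
      simp only [z, Pi.single_eq_same, Complex.norm_real, Real.norm_eq_abs]
      rw [abs_of_pos (by positivity)]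
      linarith
    · simp [z, hj, hε]
  have h3 : ∃ j, eval z (pderiv j f) ≠ 0 := by
    by_contra hc
    push Not at hc
    exact hz (h2 z hz2 hc)
  obtain ⟨j, hj⟩ := h3
  rw [eval_eq'] at hj
  obtain ⟨m, hm, hm2⟩ := Finset.exists_ne_zero_of_sum_ne_zero hj
  have hm3 : m = Finsupp.single i (m i) := by
    ext l
    by_cases hl : l = i
    · subst hl; simp
    · rw [Finsupp.single_eq_of_ne hl]
      by_contra hne
      apply hm2
      rw [Finset.prod_eq_zero (Finset.mem_univ l), mul_zero]
      simp [z, hl, hne]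
  have hc := mem_support_iff.1 hm
  rw [coeff_pderiv] at hc
  have hc := left_ne_zero_of_mul hc
  have hwt := hw hc
  rw [hm3, map_add, Finsupp.weight_single, Finsupp.weight_single] at hwt
  simp only [smul_eq_mul, one_mul] at hwt
  have hjd := hk1 j
  rcases Nat.lt_or_ge (m i) 2 with hlt | hge
  · have : m i = 0 ∨ m i = 1 := by omega
    rcases this with h0 | h0
    · rw [h0] at hwt; omega
    · by_cases hij : i = j
      · subst hij; rw [h0] at hwt; omega
      · rw [hm3, h0] at hc
        exact absurd (h1 i j hij) hc
  · nlinarith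

lemma fjr_zero {n : ℕ} (f : MvPolynomial (Fin n) ℂ) (d : ℕ) (k : Fin n → ℕ)
    (hk0 : ∀ i, 0 < k i)
    (hhom : ∀ j (lam : ℂ) (z : Fin n → ℂ), eval (fun i => lam ^ k i * z i) (pderiv j f) =
      lam ^ (d - k j) * eval z (pderiv j f)) (hnd : Nondegenerate f)
    (z : Fin n → ℂ) (hz : ∀ j, eval z (pderiv j f) = 0) : z = 0 := by
  obtain ⟨_, ε, hε, h2⟩ := hnd
  have hp : 0 < ε + ‖z‖ := by positivity
  let t : ℝ := ε / (ε + ‖z‖ + 1)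
  have ht0 : 0 < t := by positivity
  have ht1 : t ≤ 1 := by
    rw [div_le_one (by positivity)]; linarith [norm_nonneg z]
  have ht2 : t * ‖z‖ < ε := by
    have : t * ‖z‖ = ε * ‖z‖ / (ε + ‖z‖ + 1) := by simp only [t]; ring
    rw [this, div_lt_iff₀ (by positivity)]
    nlinarith [norm_nonneg z]
  have h3 := h2 (fun i => (t:ℂ) ^ k i * z i) (by
    intro i
    rw [norm_mul, norm_pow, Complex.norm_real, Real.norm_eq_abs, abs_of_pos ht0]
    have a1 : t ^ k i ≤ t := pow_le_of_le_one ht0.le ht1 (hk0 i).ne'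
    have a2 : ‖z i‖ ≤ ‖z‖ := norm_le_pi_norm z i
    calc t ^ k i * ‖z i‖ ≤ t * ‖z‖ := by gcongr
      _ < ε := ht2) (by
    intro j
    rw [hhom, hz, mul_zero])
  ext i
  have := congrFun h3 i
  simp only [Pi.zero_apply, mul_eq_zero] at this
  rcases this with h | h
  · exact absurd h (pow_ne_zero _ (by exact_mod_cast ht0.ne'))
  · exact h

lemma fjr_lower {n : ℕ} (hn : 0 < n) (f : MvPolynomial (Fin n) ℂ)
    (hz : ∀ z : Fin n → ℂ, (∀ j, eval z (pderiv j f) = 0) → z = 0) :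
    ∃ c : ℝ, 0 < c ∧ c ≤ 1 ∧ ∀ v : Fin n → ℂ, ‖v‖ = 1 → c ≤ ∑ j, ‖eval v (pderiv j f)‖ := by
  have : Nonempty (Fin n) := ⟨⟨0, hn⟩⟩
  have hK : IsCompact (Metric.sphere (0 : Fin n → ℂ) 1) := isCompact_sphere _ _
  have hne : (Metric.sphere (0 : Fin n → ℂ) 1).Nonempty := ⟨fun _ => 1, by rw [mem_sphere_zero_iff_norm, pi_norm_const, norm_one]⟩
  have hcont : Continuous fun v : Fin n → ℂ => ∑ j, ‖eval v (pderiv j f)‖ :=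
    continuous_finsetSum _ fun j _ => (MvPolynomial.continuous_eval _).norm
  obtain ⟨v0, hv0, hmin⟩ := hK.exists_isMinOn hne hcont.continuousOn
  have hpos : 0 < ∑ j, ‖eval v0 (pderiv j f)‖ := by
    refine lt_of_le_of_ne (Finset.sum_nonneg fun _ _ => norm_nonneg _) fun h => ?_
    have h0 := (Finset.sum_eq_zero_iff_of_nonneg (fun _ _ => norm_nonneg _)).1 h.symm
    have := hz v0 fun j => norm_eq_zero.1 (h0 j (Finset.mem_univ _))
    rw [this] at hv0
    simp at hv0
  refine ⟨min 1 (∑ j, ‖eval v0 (pderiv j f)‖), lt_min one_pos hpos, min_le_left _ _, ?_⟩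
  intro v hv
  exact (min_le_right _ _).trans (hmin (by simpa using hv))

lemma fjr_scale {n : ℕ} (hn : 0 < n) (k : Fin n → ℕ) (hk0 : ∀ i, 0 < k i) (u : Fin n → ℂ)
    (hu : ∃ i, 1 < ‖u i‖) :
    ∃ (t : ℝ) (v : Fin n → ℂ), 1 ≤ t ∧ ‖v‖ = 1 ∧ u = fun i => (t:ℂ) ^ k i * v i := by
  have : Nonempty (Fin n) := ⟨⟨0, hn⟩⟩
  obtain ⟨i0, hi0⟩ := Finite.exists_max fun i => ‖u i‖ ^ ((k i : ℝ)⁻¹)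
  set t : ℝ := ‖u i0‖ ^ ((k i0 : ℝ)⁻¹) with ht
  obtain ⟨i1, hi1⟩ := hu
  have ht1 : 1 ≤ t := (Real.one_le_rpow hi1.le (by positivity)).trans (hi0 i1)
  have ht0 : 0 < t := by linarith
  have hti0 : t ^ k i0 = ‖u i0‖ := Real.rpow_inv_natCast_pow (norm_nonneg _) (hk0 i0).ne'
  have hle : ∀ i, ‖u i‖ ≤ t ^ k i := fun i => by
    rw [← Real.rpow_inv_natCast_pow (norm_nonneg (u i)) (hk0 i).ne']
    gcongr
    exact hi0 i
  have htc : ∀ m : ℕ, (t:ℂ) ^ m ≠ 0 := fun m => pow_ne_zero _ (by exact_mod_cast ht0.ne')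
  have hnv : ∀ i, ‖u i / (t:ℂ) ^ k i‖ = ‖u i‖ / t ^ k i := fun i => by
    rw [norm_div, norm_pow, Complex.norm_real, Real.norm_eq_abs, abs_of_pos ht0]
  refine ⟨t, fun i => u i / (t:ℂ) ^ k i, ht1, le_antisymm ?_ ?_, ?_⟩
  · refine (pi_norm_le_iff_of_nonneg zero_le_one).2 fun i => ?_
    rw [hnv, div_le_one (by positivity)]
    exact hle i
  · have h := norm_le_pi_norm (fun i => u i / (t:ℂ) ^ k i) i0
    rw [hnv, ← hti0, div_self (by positivity)] at h
    exact h
  · ext i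
    rw [mul_div_cancel₀ _ (htc _)]

/-- The FJR growth estimate: with `γ i = q i / min_j (1 - q j)` one has `γ i ≤ 1`, and
`|u_i| ≤ C (∑_j |∂f/∂z_j(u)| + 1)^{γ_i}` for a constant `C > 0` depending only on `f`;
moreover `γ i < 1` for all `i` as soon as all weights are `< 1/2`. -/
theorem fjr_growth_estimate {n : ℕ} (hn : 0 < n) (f : MvPolynomial (Fin n) ℂ)
    (d : ℕ) (k : Fin n → ℕ) (hd : 0 < d) (hk0 : ∀ i, 0 < k i) (hk1 : ∀ i, k i < d)
    (hQH : IsQuasiHomogeneous f d k) (hnd : Nondegenerate f)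
    (q : Fin n → ℝ) (hq : ∀ i, q i = (k i : ℝ) / d)
    (γ : Fin n → ℝ)
    (hγ : ∀ i, γ i = q i /
      (Finset.univ.inf' ⟨⟨0, hn⟩, Finset.mem_univ _⟩ (fun j => 1 - q j))) :
    (∀ i, γ i ≤ 1) ∧
    (∃ C : ℝ, 0 < C ∧ ∀ u : Fin n → ℂ, ∀ i,
      ‖u i‖ ≤ C * ((∑ j, ‖eval u (pderiv j f)‖) + 1) ^ (γ i)) ∧
    ((∀ i, q i < 1 / 2) → ∀ i, γ i < 1) := by
  have hw := fjr_wh f d k hQH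
  have hhalf := fjr_half f d k hk1 hw hnd
  have hdR : (0:ℝ) < d := by exact_mod_cast hd
  have hhom : ∀ j (lam : ℂ) (z : Fin n → ℂ), eval (fun i => lam ^ k i * z i) (pderiv j f) =
      lam ^ (d - k j) * eval z (pderiv j f) := fun j lam z =>
    fjr_eval _ _ _ (hw.pderiv (Nat.sub_add_cancel (hk1 j).le)) lam z
  set δ : ℝ := Finset.univ.inf' ⟨⟨0, hn⟩, Finset.mem_univ _⟩ (fun j => 1 - q j) with hδ
  have hq2 : ∀ i, q i ≤ 1 / 2 := fun i => by
    rw [hq, div_le_iff₀ hdR]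
    have : (2:ℝ) * k i ≤ d := by exact_mod_cast hhalf i
    linarith
  have hq0 : ∀ i, 0 < q i := fun i => by
    rw [hq]
    have : (0:ℝ) < k i := by exact_mod_cast hk0 i
    positivity
  have hδ2 : 1 / 2 ≤ δ := (Finset.le_inf'_iff _ _).2 fun j _ => by linarith [hq2 j]
  have hδ0 : 0 < δ := by linarith
  have hδj : ∀ j, δ ≤ 1 - q j := fun j => Finset.inf'_le _ (Finset.mem_univ j)
  have hγ1 : ∀ i, γ i ≤ 1 := fun i => by
    rw [hγ, div_le_one hδ0]; linarith [hq2 i]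
  have hγ0 : ∀ i, 0 ≤ γ i := fun i => by
    rw [hγ]; exact div_nonneg (hq0 i).le hδ0.le
  refine ⟨hγ1, ?_, fun h i => ?_⟩
  swap
  · rw [hγ, div_lt_one hδ0]; linarith [h i]
  obtain ⟨c, hc0, hc1, hc⟩ := fjr_lower hn f (fjr_zero f d k hk0 hhom hnd)
  have hC1 : 1 ≤ 1 / c := by rw [le_div_iff₀ hc0]; linarith
  refine ⟨1 / c, by positivity, fun u i => ?_⟩
  set S := ∑ j, ‖eval u (pderiv j f)‖ with hS
  have hS0 : 0 ≤ S := Finset.sum_nonneg fun _ _ => norm_nonneg _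
  by_cases hu : ∃ i, 1 < ‖u i‖
  · obtain ⟨t, v, ht1, hv, huv⟩ := fjr_scale hn k hk0 u hu
    have ht0 : 0 < t := by linarith
    have hSt : c * t ^ ((d:ℝ) * δ) ≤ S := by
      calc c * t ^ ((d:ℝ) * δ) ≤ (∑ j, ‖eval v (pderiv j f)‖) * t ^ ((d:ℝ) * δ) := by
            gcongr; exact hc v hv
        _ ≤ S := by
            rw [hS, Finset.sum_mul]
            refine Finset.sum_le_sum fun j _ => ?_
            rw [huv, hhom, norm_mul, norm_pow, Complex.norm_real, Real.norm_eq_abs,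
              abs_of_pos ht0, mul_comm]
            gcongr
            rw [← Real.rpow_natCast]
            apply Real.rpow_le_rpow_of_exponent_le ht1
            rw [Nat.cast_sub (hk1 j).le]
            have h1 := hδj j
            have h2 : (k j : ℝ) = d * q j := by rw [hq]; field_simp
            rw [h2]
            nlinarith
    have hui : ‖u i‖ ≤ t ^ k i := by
      have := norm_le_pi_norm v i
      rw [hv] at this
      rw [huv]
      simp only [norm_mul, norm_pow, Complex.norm_real, Real.norm_eq_abs, abs_of_pos ht0]
      exact mul_le_of_le_one_right (by positivity) this
    have hpow : t ^ k i = (t ^ ((d:ℝ) * δ)) ^ γ i := by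
      rw [← Real.rpow_mul ht0.le, ← Real.rpow_natCast, hγ, hq]
      congr 1
      field_simp
    calc ‖u i‖ ≤ (t ^ ((d:ℝ) * δ)) ^ γ i := by rw [← hpow]; exact hui
      _ ≤ ((1 / c) * (S + 1)) ^ γ i := by
          apply Real.rpow_le_rpow (by positivity) _ (hγ0 i)
          rw [one_div, ← div_eq_inv_mul, le_div_iff₀ hc0]
          linarith
      _ = (1 / c) ^ γ i * (S + 1) ^ γ i := Real.mul_rpow (by positivity) (by positivity)
      _ ≤ (1 / c) * (S + 1) ^ γ i := by
          gcongr
          calc (1 / c) ^ γ i ≤ (1 / c) ^ (1:ℝ) :=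
                Real.rpow_le_rpow_of_exponent_le hC1 (hγ1 i)
            _ = 1 / c := Real.rpow_one _
  · push Not at hu
    have h1 : 1 ≤ (S + 1) ^ γ i := Real.one_le_rpow (by linarith) (hγ0 i)
    calc ‖u i‖ ≤ 1 * 1 := by rw [mul_one]; exact hu i
      _ ≤ (1 / c) * (S + 1) ^ γ i := by gcongr
end

section
/- Let f ∈ ℂ[z₁,…,zₙ] be a nondegenerate quasi-homogeneous polynomial. Then there exists a constant C > 0, depending only on f, such that for all z ∈ ℂⁿ, |∂f(z)|² ≥ |z|²/C − 1, where |∂f(z)|² = ∑_{i=1}ⁿ |∂f/∂z_i(z)|² and |z|² = ∑_{i=1}ⁿ |z_i|². -/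
open MvPolynomial

theorem aux_coeff {n : ℕ} (c : Fin n → ℂ) (f : MvPolynomial (Fin n) ℂ) (m : Fin n →₀ ℕ) :
    coeff m (bind₁ (fun i => C (c i) * X i) f) = (∏ i, c i ^ m i) * coeff m f := by
  induction f using MvPolynomial.induction_on' with
  | add p q hp hq => simp only [map_add, coeff_add, hp, hq, mul_add]
  | monomial u a =>
    have h : bind₁ (fun i => C (c i) * X i) (monomial u a)
        = C (∏ i, c i ^ u i) * monomial u a := by
      rw [bind₁_monomial]
      rw [Finset.prod_subset (Finset.subset_univ _)]
      · simp only [mul_pow, Finset.prod_mul_distrib, map_prod, map_pow]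
        rw [monomial_eq, Finsupp.prod_fintype _ _ (by simp)]
        ring
      · intro i _ hi
        simp [Finsupp.notMem_support_iff.mp hi]
    rw [h, coeff_C_mul, coeff_monomial]
    split_ifs with h1
    · rw [h1]
    · simp

theorem aux_wh {n : ℕ} (f : MvPolynomial (Fin n) ℂ) (d : ℕ) (k : Fin n → ℕ)
    (hQH : IsQuasiHomogeneous f d k) : IsWeightedHomogeneous k f d := by
  intro m hm
  have h : bind₁ (fun i => C ((2:ℂ) ^ k i) * X i) f = C ((2:ℂ) ^ d) * f := by
    apply MvPolynomial.funext
    intro z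
    have := hQH 2 z
    rw [map_mul, eval_C, ← this]
    change eval₂Hom _ _ _ = _
    rw [eval₂Hom_bind₁]
    have hg : (fun i => eval z (C ((2:ℂ) ^ k i) * X i)) = fun i => (2:ℂ) ^ k i * z i := by
      funext i
      rw [map_mul, eval_C, eval_X]
    exact congrArg (fun g => eval g f) hg
  have h2 := congrArg (coeff m) h
  rw [aux_coeff, coeff_C_mul] at h2
  have h3 := mul_right_cancel₀ hm h2
  simp only [← pow_mul] at h3
  rw [Finset.prod_pow_eq_pow_sum] at h3
  have h4 : (2:ℕ) ^ (∑ i, k i * m i) = 2 ^ d := by exact_mod_cast h3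
  have h5 := Nat.pow_right_injective (le_refl 2) h4
  rw [Finsupp.weight_apply, Finsupp.sum_fintype _ _ (by simp), ← h5]
  exact Finset.sum_congr rfl (fun i _ => by simp [mul_comm])

theorem aux_eval {n : ℕ} (f : MvPolynomial (Fin n) ℂ) (d : ℕ) (k : Fin n → ℕ)
    (h : IsWeightedHomogeneous k f d) (lam : ℂ) (z : Fin n → ℂ) :
    eval (fun i => lam ^ k i * z i) f = lam ^ d * eval z f := by
  rw [eval_eq', eval_eq', Finset.mul_sum]
  refine Finset.sum_congr rfl (fun m hm => ?_)
  have h1 := h (mem_support_iff.mp hm)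
  rw [Finsupp.weight_apply, Finsupp.sum_fintype _ _ (by simp)] at h1
  have h2 : ∏ i, (lam ^ k i) ^ m i = lam ^ d := by
    simp only [← pow_mul]
    rw [Finset.prod_pow_eq_pow_sum, ← h1]
    congr 1
    exact Finset.sum_congr rfl (fun i _ => by simp [mul_comm])
  simp only [mul_pow, Finset.prod_mul_distrib]
  rw [h2]; ring

theorem aux_pderiv {n : ℕ} (f : MvPolynomial (Fin n) ℂ) (d : ℕ) (k : Fin n → ℕ)
    (hk1 : ∀ i, k i < d) (h : IsWeightedHomogeneous k f d) (lam : ℂ) (z : Fin n → ℂ) (j : Fin n) :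
    eval (fun i => lam ^ k i * z i) (pderiv j f) = lam ^ (d - k j) * eval z (pderiv j f) :=
  aux_eval _ _ _ (h.pderiv (Nat.sub_add_cancel (hk1 j).le)) lam z

theorem aux_zero {n : ℕ} (f : MvPolynomial (Fin n) ℂ) (d : ℕ) (k : Fin n → ℕ)
    (hk0 : ∀ i, 0 < k i) (hk1 : ∀ i, k i < d) (h : IsWeightedHomogeneous k f d)
    (hnd : Nondegenerate f) (w : Fin n → ℂ) (hw : ∀ i, eval w (pderiv i f) = 0) : w = 0 := by
  obtain ⟨-, ε, hε, H⟩ := hnd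
  obtain ⟨t, ht0, ht1, ht⟩ : ∃ t : ℝ, 0 < t ∧ t ≤ 1 ∧ t * (‖w‖ + 1) < ε := by
    have hp : 0 < ‖w‖ + 1 := by positivity
    refine ⟨min 1 (ε / 2 / (‖w‖ + 1)), by positivity, min_le_left _ _, ?_⟩
    calc _ ≤ (ε / 2 / (‖w‖ + 1)) * (‖w‖ + 1) := by gcongr; exact min_le_right _ _
      _ = ε / 2 := by field_simp
      _ < ε := by linarith
  have h1 := H (fun i => (t:ℂ) ^ k i * w i) ?_ ?_
  · funext i
    have h2 := congrFun h1 i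
    simp only [Pi.zero_apply, mul_eq_zero] at h2
    rcases h2 with h2 | h2
    · exact absurd h2 (pow_ne_zero _ (by exact_mod_cast ht0.ne'))
    · exact h2
  · intro i
    rw [norm_mul, norm_pow, Complex.norm_real, Real.norm_of_nonneg ht0.le]
    refine lt_of_le_of_lt ?_ ht
    have h3 := norm_le_pi_norm w i
    have h4 : t ^ k i ≤ t := pow_le_of_le_one ht0.le ht1 (hk0 i).ne'
    gcongr
    linarith
  · intro i
    rw [aux_pderiv f d k hk1 h, hw, mul_zero]

theorem aux_half {n : ℕ} (f : MvPolynomial (Fin n) ℂ) (d : ℕ) (k : Fin n → ℕ)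
    (hk0 : ∀ i, 0 < k i) (hk1 : ∀ i, k i < d) (h : IsWeightedHomogeneous k f d)
    (hnd : Nondegenerate f) (i : Fin n) : 2 * k i ≤ d := by
  by_contra hlt
  have h0 : (Pi.single i 1 : Fin n → ℂ) = 0 := by
    refine aux_zero f d k hk0 hk1 h hnd _ (fun j => ?_)
    rw [eval_eq']
    refine Finset.sum_eq_zero (fun m hm => ?_)
    by_cases hmi : ∀ l, l ≠ i → m l = 0
    · exfalso
      have hm' : m = Finsupp.single i (m i) := by
        ext l
        by_cases hl : l = i
        · subst hl; simp
        · rw [hmi l hl, Finsupp.single_eq_of_ne hl]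
      rw [mem_support_iff, coeff_pderiv] at hm
      have hc := left_ne_zero_of_mul hm
      have hwt := h hc
      rw [hm'] at hwt hc
      generalize m i = a at hwt hc
      rw [map_add, Finsupp.weight_single, Finsupp.weight_single] at hwt
      simp only [smul_eq_mul, one_mul] at hwt
      have := hk1 j
      match a, hwt, hc with
      | 0, hwt, hc => omega
      | 1, hwt, hc =>
        by_cases hij : i = j
        · subst hij; omega
        · exact hc (hnd.1 i j hij)
      | a + 2, hwt, hc =>
        apply hlt
        rw [← hwt]
        nlinarith [Nat.zero_le (a * k i)]
    · push Not at hmi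
      obtain ⟨l, hl, hml⟩ := hmi
      rw [Finset.prod_eq_zero (Finset.mem_univ l), mul_zero]
      rw [Pi.single_eq_of_ne hl, zero_pow hml]
  have := congrFun h0 i
  simp at this

/-- For a nondegenerate quasi-homogeneous polynomial `f` there is a constant `C > 0`,
depending only on `f`, such that `|∂f(z)|² ≥ |z|²/C − 1` for all `z ∈ ℂⁿ`. -/
theorem gradient_lower_bound {n : ℕ} (f : MvPolynomial (Fin n) ℂ)
    (d : ℕ) (k : Fin n → ℕ) (hd : 0 < d) (hk0 : ∀ i, 0 < k i) (hk1 : ∀ i, k i < d)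
    (hQH : IsQuasiHomogeneous f d k) (hnd : Nondegenerate f) :
    ∃ C : ℝ, 0 < C ∧ ∀ z : Fin n → ℂ,
      (∑ i, ‖z i‖ ^ 2) / C - 1 ≤ ∑ i, ‖eval z (pderiv i f)‖ ^ 2 := by
  have hwh := aux_wh f d k hQH
  have hhalf := aux_half f d k hk0 hk1 hwh hnd
  have hz := aux_zero f d k hk0 hk1 hwh hnd
  obtain ⟨c, hc, hcb⟩ : ∃ c : ℝ, 0 < c ∧ ∀ w : Fin n → ℂ, ‖w‖ = 1 →
      c ≤ ∑ i, ‖eval w (pderiv i f)‖ ^ 2 := by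
    have hcont : Continuous (fun w : Fin n → ℂ => ∑ i, ‖eval w (pderiv i f)‖ ^ 2) :=
      continuous_finsetSum _ (fun i _ => (((pderiv i f).continuous_eval).norm).pow 2)
    rcases (Metric.sphere (0 : Fin n → ℂ) 1).eq_empty_or_nonempty with he | hne
    · refine ⟨1, one_pos, fun w hw => ?_⟩
      have : w ∈ Metric.sphere (0 : Fin n → ℂ) 1 := by simpa using hw
      rw [he] at this
      exact absurd this (by simp)
    · obtain ⟨w0, hw0, hmin⟩ :=
        (isCompact_sphere (0 : Fin n → ℂ) 1).exists_isMinOn hne hcont.continuousOn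
      refine ⟨_, ?_, fun w hw => hmin (by simpa using hw)⟩
      have hnn : 0 ≤ ∑ i, ‖eval w0 (pderiv i f)‖ ^ 2 :=
        Finset.sum_nonneg (fun i _ => by positivity)
      refine lt_of_le_of_ne hnn (fun h0 => ?_)
      have h1 := (Finset.sum_eq_zero_iff_of_nonneg (fun i _ => by positivity)).mp h0.symm
      have h2 := hz w0 (fun i => by simpa using h1 i (Finset.mem_univ i))
      rw [h2] at hw0
      simp at hw0
  have hn0 : (0:ℝ) ≤ n := Nat.cast_nonneg n
  have hnc : (0:ℝ) ≤ n / c := by positivity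
  have hC : (0:ℝ) < n / c + n + 1 := by positivity
  refine ⟨n / c + n + 1, hC, fun z => ?_⟩
  have hR : 0 ≤ ∑ i, ‖eval z (pderiv i f)‖ ^ 2 :=
    Finset.sum_nonneg (fun i _ => by positivity)
  have hbd : ∀ B : ℝ, (∀ i, ‖z i‖ ^ 2 ≤ B) → ∑ i, ‖z i‖ ^ 2 ≤ n * B := by
    intro B hB
    calc _ ≤ ∑ _i : Fin n, B := Finset.sum_le_sum (fun i _ => hB i)
      _ = n * B := by simp
  by_cases hsmall : ∀ i, ‖z i‖ ≤ 1
  · have h1 := hbd 1 (fun i => pow_le_one₀ (norm_nonneg _) (hsmall i))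
    have h2 : (∑ i, ‖z i‖ ^ 2) / (n / c + n + 1) ≤ 1 := by
      rw [div_le_one hC]; linarith
    linarith
  push Not at hsmall
  obtain ⟨i1, hi1⟩ := hsmall
  obtain ⟨i0, -, hmax⟩ := Finset.exists_max_image Finset.univ
    (fun i => ‖z i‖ ^ ((k i : ℝ)⁻¹)) ⟨i1, Finset.mem_univ _⟩
  obtain ⟨t, ht⟩ : ∃ t, t = ‖z i0‖ ^ ((k i0 : ℝ)⁻¹) := ⟨_, rfl⟩
  have hkey : ∀ i, (‖z i‖ ^ ((k i : ℝ)⁻¹)) ^ k i = ‖z i‖ := fun i =>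
    Real.rpow_inv_natCast_pow (norm_nonneg _) (hk0 i).ne'
  have ht1 : 1 ≤ t := by
    rw [ht]
    refine le_trans ?_ (hmax i1 (Finset.mem_univ _))
    exact Real.one_le_rpow hi1.le (by positivity)
  have ht0 : 0 < t := by linarith
  have htc : (t:ℂ) ≠ 0 := by exact_mod_cast ht0.ne'
  have hle : ∀ i, ‖z i‖ ≤ t ^ k i := by
    intro i
    rw [← hkey i, ht]
    exact pow_le_pow_left₀ (by positivity) (hmax i (Finset.mem_univ _)) _
  have heq : ‖z i0‖ = t ^ k i0 := by rw [ht, hkey]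
  obtain ⟨w, hw⟩ : ∃ w : Fin n → ℂ, w = fun i => z i / (t:ℂ) ^ k i := ⟨_, rfl⟩
  have hwn : ∀ i, ‖w i‖ = ‖z i‖ / t ^ k i := by
    intro i
    rw [hw]
    simp only [norm_div, norm_pow, Complex.norm_real, Real.norm_of_nonneg ht0.le]
  have hw1 : ‖w‖ = 1 := by
    apply le_antisymm
    · rw [pi_norm_le_iff_of_nonneg zero_le_one]
      intro i
      rw [hwn, div_le_one (by positivity)]
      exact hle i
    · refine le_trans (le_of_eq ?_) (norm_le_pi_norm w i0)
      rw [hwn, heq, div_self (by positivity)]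
  have hzw : z = fun i => (t:ℂ) ^ k i * w i := by
    funext i
    rw [hw]
    field_simp
  have hlow : t ^ d * c ≤ ∑ i, ‖eval z (pderiv i f)‖ ^ 2 := by
    calc t ^ d * c ≤ t ^ d * ∑ i, ‖eval w (pderiv i f)‖ ^ 2 := by
          gcongr; exact hcb w hw1
      _ = ∑ i, t ^ d * ‖eval w (pderiv i f)‖ ^ 2 := Finset.mul_sum _ _ _
      _ ≤ _ := by
          refine Finset.sum_le_sum (fun i _ => ?_)
          rw [hzw, aux_pderiv f d k hk1 hwh, norm_mul, norm_pow, Complex.norm_real,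
            Real.norm_of_nonneg ht0.le, mul_pow, ← pow_mul]
          gcongr
          have := hhalf i
          omega
  have hup : ∑ i, ‖z i‖ ^ 2 ≤ n * t ^ d := by
    apply hbd
    intro i
    calc ‖z i‖ ^ 2 ≤ (t ^ k i) ^ 2 := by gcongr; exact hle i
      _ = t ^ (k i * 2) := by rw [← pow_mul]
      _ ≤ t ^ d := by
        gcongr
        have := hhalf i
        omega
  have hfin : (∑ i, ‖z i‖ ^ 2) / (n / c + n + 1) ≤ t ^ d * c := by
    rw [div_le_iff₀ hC]
    have hp : 0 < t ^ d * c := by positivity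
    have : t ^ d * c * (n / c + n + 1) = n * t ^ d + t ^ d * c * (n + 1) := by
      field_simp
      ring
    rw [this]
    have : 0 ≤ t ^ d * c * (n + 1) := by positivity
    linarith
  linarith
end

section
/- Let f ∈ ℂ[z₁,…,zₙ] be a nondegenerate quasi-homogeneous polynomial with weights q₁,…,qₙ satisfying q_M − q_m < 1/3, where q_M = max_i q_i and q_m = min_i q_i. Let μ(f) = dim_ℂ ℂ[z₁,…,zₙ]/(∂f/∂z₁,…,∂f/∂zₙ) be the Milnor number of f. Then for every real t > 0, μ(f) = (tⁿ/πⁿ) ∫_{ℂⁿ} exp(−t|∂f(z)|²) |det(∂²f/∂z_i∂z_j(z))_{i,j}|² dvol(z), where the integral is with respect to Lebesgue measure on ℂⁿ ≅ ℝ^{2n}. In particular, taking f(z) = z²/2 recovers πⁿ = ∫_{ℂⁿ} e^{−|z|²} dvol. -/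
open MvPolynomial MeasureTheory


/-- The Milnor number of `f`: the complex dimension of the Jacobian quotient ring
`ℂ[z₁,…,zₙ]/(∂f/∂z₁,…,∂f/∂zₙ)`. -/
noncomputable def milnorNumber {n : ℕ} (f : MvPolynomial (Fin n) ℂ) : ℕ :=
  Module.finrank ℂ
    (MvPolynomial (Fin n) ℂ ⧸ Ideal.span (Set.range fun i => pderiv i f))

section Aux
open RingTheory.Sequence

lemma cm_dim_one {R : Type*} [CommRing R] [IsLocalRing R] [IsNoetherianRing R] (I : Ideal R)
    (x l : R) (hxm : x ∈ IsLocalRing.maximalIdeal R)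
    (hx : ∀ P : Ideal R, P.IsPrime → I ≤ P → x ∈ P → P = IsLocalRing.maximalIdeal R)
    (hl : ∀ Q ∈ I.minimalPrimes, Q ≠ IsLocalRing.maximalIdeal R → l ∉ Q)
    (P : Ideal R) (hP : P.IsPrime) (hIP : I ≤ P) (hlP : l ∈ P) :
    P = IsLocalRing.maximalIdeal R := by
  obtain ⟨Q, hQ, hQP⟩ := Ideal.exists_minimalPrimes_le hIP
  by_cases hQm : Q = IsLocalRing.maximalIdeal R
  · exact le_antisymm (IsLocalRing.le_maximalIdeal hP.ne_top) (hQm ▸ hQP)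
  have hlQ := hl Q hQ hQm
  have hQp : Q.IsPrime := hQ.1.1
  by_contra hPm
  set π := Ideal.Quotient.mk Q
  have hπ : Function.Surjective π := Ideal.Quotient.mk_surjective
  set m := IsLocalRing.maximalIdeal R
  have hQm' : Q ≤ m := IsLocalRing.le_maximalIdeal hQp.ne_top
  have hmp : m.IsPrime := inferInstance
  have h1 : (m.map π).IsPrime := Ideal.isPrime_map_quotientMk_of_isPrime hQm'
  have h2 : (P.map π).IsPrime := Ideal.isPrime_map_quotientMk_of_isPrime hQP
  have cm : ∀ K : Ideal R, Q ≤ K → (K.map π).comap π = K := fun K hK => by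
    rw [Ideal.comap_map_of_surjective _ hπ, sup_eq_left, ← RingHom.ker_eq_comap_bot,
      Ideal.mk_ker]
    exact hK
  have hmin : m.map π ∈ (Ideal.span {π x}).minimalPrimes := by
    refine ⟨⟨h1, ?_⟩, ?_⟩
    · rw [Ideal.span_singleton_le_iff_mem]; exact Ideal.mem_map_of_mem _ hxm
    · rintro K ⟨hK, hxK⟩ hKm
      rw [Ideal.span_singleton_le_iff_mem] at hxK
      have : K.comap π = m := hx _ (hK.comap π) (hQ.1.2.trans (by
        intro q hq; rw [Ideal.mem_comap, Ideal.Quotient.eq_zero_iff_mem.2 hq]; exact K.zero_mem)) hxK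
      rw [← this, Ideal.map_comap_of_surjective _ hπ]
  have hh := Ideal.height_le_one_of_isPrincipal_of_mem_minimalPrimes _ _ hmin
  have hlt : P.map π < m.map π := by
    refine lt_of_le_of_ne (Ideal.map_mono (IsLocalRing.le_maximalIdeal hP.ne_top)) fun h => hPm ?_
    rw [← cm P hQP, h, cm m hQm']
  have h3 := (Ideal.height_le_iff (n := 1)).1 (by exact_mod_cast hh) _ h2 hlt
  have h4 : (P.map π).height ≤ ((0:ℕ) : ℕ∞) := by
    rw [Nat.cast_one, Order.lt_one_iff] at h3
    simp [h3]
  have h5 := Ideal.height_le_iff.1 h4 ⊥ Ideal.isPrime_bot (by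
    rw [bot_lt_iff_ne_bot]
    intro h
    apply hlQ
    rw [← Ideal.Quotient.eq_zero_iff_mem, ← Ideal.mem_bot, ← h]
    exact Ideal.mem_map_of_mem _ hlP)
  simp at h5

lemma cm_avoid {R : Type*} [CommRing R] [IsLocalRing R] [IsNoetherianRing R] (I J : Ideal R) :
    ∃ l ∈ IsLocalRing.maximalIdeal R,
      (∀ Q ∈ I.minimalPrimes, Q ≠ IsLocalRing.maximalIdeal R → l ∉ Q) ∧
      (∀ Q ∈ J.minimalPrimes, Q ≠ IsLocalRing.maximalIdeal R → l ∉ Q) := by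
  by_contra! hc
  have hf : ((I.minimalPrimes ∪ J.minimalPrimes) \ {IsLocalRing.maximalIdeal R}).Finite :=
    ((Ideal.finite_minimalPrimes_of_isNoetherianRing R I).union
      (Ideal.finite_minimalPrimes_of_isNoetherianRing R J)).sdiff
  have := (Ideal.subset_union_prime_finite hf (f := id) ⊤ ⊤ (I := IsLocalRing.maximalIdeal R) (by
    rintro i ⟨hi | hi, -⟩ - -
    · exact hi.1.1
    · exact hi.1.1)).1 (by
      intro l hl
      simp only [Set.mem_iUnion]
      by_cases h : ∀ Q ∈ I.minimalPrimes, Q ≠ IsLocalRing.maximalIdeal R → l ∉ Q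
      · obtain ⟨Q, hQ, hQ2, hQ3⟩ := hc l hl h
        exact ⟨Q, ⟨Or.inr hQ, hQ2⟩, hQ3⟩
      · push Not at h
        obtain ⟨Q, hQ, hQ2, hQ3⟩ := h
        exact ⟨Q, ⟨Or.inl hQ, hQ2⟩, hQ3⟩)
  obtain ⟨Q, ⟨hQ, hQm⟩, hle⟩ := this
  apply hQm
  have hQp : Q.IsPrime := by rcases hQ with h | h <;> exact h.1.1
  exact le_antisymm (IsLocalRing.le_maximalIdeal hQp.ne_top) hle

/-- exchange -/
lemma cm_exchange {R M : Type*} [CommRing R] [AddCommGroup M] [Module R M] (rs : List R) (x l : R)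
    (m : Ideal R) (hxm : x ∈ m)
    (h : ∀ P : Ideal R, P.IsPrime → Module.annihilator R M ⊔ Ideal.ofList rs ≤ P → l ∈ P → P = m)
    (hreg : IsWeaklyRegular M (rs ++ [x])) : IsWeaklyRegular M (rs ++ [l]) := by
  rw [isWeaklyRegular_append_iff, isWeaklyRegular_singleton_iff] at hreg ⊢
  refine ⟨hreg.1, ?_⟩
  have hx : x ∈ (Module.annihilator R M ⊔ Ideal.ofList rs ⊔ Ideal.span {l}).radical := by
    rw [Ideal.radical_eq_sInf, Ideal.mem_sInf]
    rintro P ⟨hP, hPp⟩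
    rw [h P hPp (le_sup_left.trans hP) (hP (Ideal.mem_sup_right (Ideal.mem_span_singleton_self l)))]
    exact hxm
  obtain ⟨N, hN⟩ := Ideal.mem_radical_iff.1 hx
  obtain ⟨a, ha, b, hb, hab⟩ := Submodule.mem_sup.1 hN
  obtain ⟨c, rfl⟩ := Ideal.mem_span_singleton'.1 hb
  have hreg2 := hreg.2.pow N
  refine IsSMulRegular.of_mul (a := c) ?_
  intro u v huv
  apply hreg2
  have key : ∀ u : M ⧸ (Ideal.ofList rs • ⊤ : Submodule R M), a • u = 0 := by
    intro u
    obtain ⟨a1, h1, a2, h2, rfl⟩ := Submodule.mem_sup.1 ha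
    obtain ⟨u, rfl⟩ := Submodule.Quotient.mk_surjective _ u
    rw [← Submodule.Quotient.mk_smul, Submodule.Quotient.mk_eq_zero, add_smul,
      Module.mem_annihilator.1 h1, zero_add]
    exact Submodule.smul_mem_smul h2 trivial
  simp only at huv ⊢
  rw [← hab, add_smul, add_smul, key, key, huv]

theorem cm_main {R : Type*} [CommRing R] [IsLocalRing R] [IsNoetherianRing R] (n : ℕ) :
    ∀ (M : Type*) [AddCommGroup M] [Module R M] [Module.Finite R M] (xs fs : List R),
      xs.length = n → fs.length = n →
      (∀ r ∈ xs, r ∈ IsLocalRing.maximalIdeal R) →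
      (∀ r ∈ fs, r ∈ IsLocalRing.maximalIdeal R) →
      (∀ P : Ideal R, P.IsPrime → Module.annihilator R M ⊔ Ideal.ofList xs ≤ P →
        P = IsLocalRing.maximalIdeal R) →
      (∀ P : Ideal R, P.IsPrime → Module.annihilator R M ⊔ Ideal.ofList fs ≤ P →
        P = IsLocalRing.maximalIdeal R) →
      IsWeaklyRegular M xs → IsWeaklyRegular M fs := by
  induction n with
  | zero =>
    intro M _ _ _ xs fs _ h2 _ _ _ _ _
    rw [List.length_eq_zero_iff.1 h2]
    exact IsWeaklyRegular.nil R M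
  | succ n ih =>
    intro M _ _ _ xs fs hxl hfl hxm hfm hxP hfP hreg
    obtain ⟨xs, x, rfl⟩ := List.eq_nil_or_concat' xs |>.resolve_left (by rintro rfl; simp at hxl)
    obtain ⟨fs, f, rfl⟩ := List.eq_nil_or_concat' fs |>.resolve_left (by rintro rfl; simp at hfl)
    simp only [List.length_append, List.length_singleton, Nat.add_right_cancel_iff] at hxl hfl
    simp only [List.mem_append, List.mem_singleton] at hxm hfm
    simp only [Ideal.ofList_append, Ideal.ofList_singleton, ← sup_assoc] at hxP hfP
    obtain ⟨l, hlm, hl1, hl2⟩ := cm_avoid (Module.annihilator R M ⊔ Ideal.ofList xs)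
      (Module.annihilator R M ⊔ Ideal.ofList fs)
    have kx := cm_dim_one _ x l (hxm x (Or.inr rfl)) (fun P hP h1 h2 => hxP P hP (sup_le h1
      ((Ideal.span_singleton_le_iff_mem _).2 h2))) hl1
    have kf := cm_dim_one _ f l (hfm f (Or.inr rfl)) (fun P hP h1 h2 => hfP P hP (sup_le h1
      ((Ideal.span_singleton_le_iff_mem _).2 h2))) hl2
    have r1 := cm_exchange xs x l _ (hxm x (Or.inr rfl)) kx hreg
    have r2 : IsWeaklyRegular M (l :: xs) :=
      IsLocalRing.isWeaklyRegular_of_perm_of_subset_maximalIdeal r1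
        (List.perm_append_singleton l xs) (by
          simp only [List.mem_append, List.mem_singleton]
          rintro r (hr | rfl)
          · exact hxm r (Or.inl hr)
          · exact hlm)
    rw [isWeaklyRegular_cons_iff] at r2
    have hann : Module.annihilator R M ⊔ Ideal.span {l} ≤
        Module.annihilator R (QuotSMulTop l M) := by
      refine sup_le ?_ ?_
      · intro a ha
        rw [Module.mem_annihilator] at ha ⊢
        intro u
        obtain ⟨u, rfl⟩ := Submodule.Quotient.mk_surjective _ u
        rw [← Submodule.Quotient.mk_smul, ha, Submodule.Quotient.mk_zero]
      · rw [Ideal.span_singleton_le_iff_mem, Module.mem_annihilator]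
        intro u
        obtain ⟨u, rfl⟩ := Submodule.Quotient.mk_surjective _ u
        rw [← Submodule.Quotient.mk_smul, Submodule.Quotient.mk_eq_zero]
        exact Submodule.smul_mem_pointwise_smul _ _ _ trivial
    have r3 := ih (QuotSMulTop l M) xs fs hxl hfl (fun r hr => hxm r (Or.inl hr))
      (fun r hr => hfm r (Or.inl hr))
      (fun P hP h => kx P hP (sup_le ((le_sup_left.trans hann).trans (le_sup_left.trans h))
        (le_sup_right.trans h)) (h (Ideal.mem_sup_left (hann
          (Ideal.mem_sup_right (Ideal.mem_span_singleton_self l))))))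
      (fun P hP h => kf P hP (sup_le ((le_sup_left.trans hann).trans (le_sup_left.trans h))
        (le_sup_right.trans h)) (h (Ideal.mem_sup_left (hann
          (Ideal.mem_sup_right (Ideal.mem_span_singleton_self l)))))) r2.2
    have r4 : IsWeaklyRegular M (l :: fs) := (isWeaklyRegular_cons_iff _ _ _).2 ⟨r2.1, r3⟩
    have r5 : IsWeaklyRegular M (fs ++ [l]) :=
      IsLocalRing.isWeaklyRegular_of_perm_of_subset_maximalIdeal r4
        (List.perm_append_singleton l fs).symm (by
          simp only [List.mem_cons]
          rintro r (rfl | hr)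
          · exact hlm
          · exact hfm r (Or.inl hr))
    exact cm_exchange fs l f _ hlm (fun P hP h1 h2 => hfP P hP (sup_le h1
      ((Ideal.span_singleton_le_iff_mem _).2 h2))) r5


lemma finrank_const {C : Type*} [CommRing C] [Algebra ℂ C] (T : C)
    (hfin : (Polynomial.aeval T : Polynomial ℂ →ₐ[ℂ] C).toRingHom.Finite)
    (hnzd : ∀ (c : ℂ) (a : C), (T - algebraMap ℂ C c) * a = 0 → a = 0) :
    ∃ r : ℕ, ∀ c : ℂ, Module.finrank ℂ (C ⧸ Ideal.span {T - algebraMap ℂ C c}) = r := by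
  let : Algebra (Polynomial ℂ) C := (Polynomial.aeval T : Polynomial ℂ →ₐ[ℂ] C).toRingHom.toAlgebra
  have : Module.Finite (Polynomial ℂ) C := hfin
  have hsm : ∀ (p : Polynomial ℂ) (a : C), p • a = Polynomial.aeval T p * a := fun p a => rfl
  have key : ∀ (s : Multiset ℂ) (a : C),
      Polynomial.aeval T (s.map (fun c => Polynomial.X - Polynomial.C c)).prod * a = 0 → a = 0 := by
    intro s
    induction s using Multiset.induction_on with
    | empty => intro a h; simpa using h
    | cons c s ih =>
      intro a h
      rw [Multiset.map_cons, Multiset.prod_cons, map_mul, mul_assoc] at h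
      apply ih
      apply hnzd c
      simpa using h
  have : Module.IsTorsionFree (Polynomial ℂ) C := by
    refine Module.IsTorsionFree.mk fun p hp => ?_
    have hp0 : p ≠ 0 := hp.ne_zero
    intro a b hab
    simp only [hsm] at hab
    rw [← sub_eq_zero, ← mul_sub] at hab
    rw [← sub_eq_zero]
    rw [(IsAlgClosed.splits p).eq_prod_roots, map_mul, Polynomial.aeval_C, mul_assoc] at hab
    apply key p.roots
    have hu : IsUnit (algebraMap ℂ C p.leadingCoeff) :=
      (IsUnit.mk0 _ (Polynomial.leadingCoeff_ne_zero.2 hp0)).map _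
    exact (hu.mul_right_eq_zero).1 hab
  have : Module.Free (Polynomial ℂ) C := Module.free_of_finite_type_torsion_free'
  let b := Module.Free.chooseBasis (Polynomial ℂ) C
  refine ⟨Fintype.card (Module.Free.ChooseBasisIndex (Polynomial ℂ) C), fun c => ?_⟩
  let L : C →ₗ[ℂ] (Module.Free.ChooseBasisIndex (Polynomial ℂ) C → ℂ) :=
    { toFun := fun a i => (b.repr a i).eval c
      map_add' := fun a a' => by ext i; simp
      map_smul' := fun s a => by
        have : s • a = (Polynomial.C s) • a := by
          rw [hsm, Polynomial.aeval_C, Algebra.smul_def]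
        ext i
        simp [this] }
  have hL : Function.Surjective L := by
    intro v
    refine ⟨b.equivFun.symm (fun i => Polynomial.C (v i)), ?_⟩
    ext i
    change (b.equivFun (b.equivFun.symm _) i).eval c = v i
    rw [LinearEquiv.apply_symm_apply, Polynomial.eval_C]
  have hker : LinearMap.ker L = (Ideal.span {T - algebraMap ℂ C c}).restrictScalars ℂ := by
    ext a
    rw [LinearMap.mem_ker, Submodule.restrictScalars_mem, Ideal.mem_span_singleton']
    have hX : ∀ x : C, (Polynomial.X - Polynomial.C c : Polynomial ℂ) • x =
        x * (T - algebraMap ℂ C c) := by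
      intro x; rw [hsm]; simp [mul_comm]
    constructor
    · intro h
      have h1 : ∀ i, (Polynomial.X - Polynomial.C c) ∣ b.repr a i := fun i =>
        Polynomial.dvd_iff_isRoot.2 (congrFun h i)
      choose g hg using h1
      refine ⟨b.equivFun.symm g, ?_⟩
      rw [← hX]
      apply b.equivFun.injective
      rw [map_smul, LinearEquiv.apply_symm_apply]
      ext1 i
      rw [Pi.smul_apply, smul_eq_mul, ← hg i]
      rfl
    · rintro ⟨x, rfl⟩
      rw [← hX]
      ext i
      change (b.repr _ i).eval c = 0
      simp
  have e := (Submodule.quotEquivOfEq _ _ hker.symm).trans (L.quotKerEquivOfSurjective hL)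
  have e2 : (C ⧸ Ideal.span {T - algebraMap ℂ C c}) ≃ₗ[ℂ]
      (C ⧸ (Ideal.span {T - algebraMap ℂ C c}).restrictScalars ℂ) :=
    (Submodule.Quotient.restrictScalarsEquiv ℂ _).symm
  rw [(e2.trans e).finrank_eq, Module.finrank_pi]


lemma mvpoly_subst_sub_mem {n : ℕ} (p : Fin n → ℂ) (S : Set (Fin n)) [DecidablePred (· ∈ S)]
    (a : MvPolynomial (Fin n) ℂ) :
    a - aeval (fun j => if j ∈ S then C (p j) else X j : Fin n → MvPolynomial (Fin n) ℂ) a ∈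
      Ideal.span ((fun j => (X j - C (p j) : MvPolynomial (Fin n) ℂ)) '' S) := by
  set I := Ideal.span ((fun j => (X j - C (p j) : MvPolynomial (Fin n) ℂ)) '' S)
  rw [← Ideal.Quotient.eq_zero_iff_mem, map_sub, sub_eq_zero]
  have : (Ideal.Quotient.mkₐ ℂ I) = (Ideal.Quotient.mkₐ ℂ I).comp
      (aeval (fun j => if j ∈ S then C (p j) else X j : Fin n → MvPolynomial (Fin n) ℂ)) := by
    apply MvPolynomial.algHom_ext
    intro j
    simp only [AlgHom.comp_apply, aeval_X]
    split_ifs with h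
    · rw [← sub_eq_zero, ← map_sub]
      exact Ideal.Quotient.eq_zero_iff_mem.2 (Ideal.subset_span ⟨j, h, rfl⟩)
    · rfl
  exact DFunLike.congr_fun this a

lemma mvpoly_coord_regular {n : ℕ} (p : Fin n → ℂ) :
    IsWeaklyRegular (MvPolynomial (Fin n) ℂ)
      (List.ofFn fun j => (X j - C (p j) : MvPolynomial (Fin n) ℂ)) := by
  classical
  refine ⟨fun i hi => ?_⟩
  have hi' : i < n := by simpa using hi
  have hid : Ideal.ofList ((List.ofFn fun j => (X j - C (p j) : MvPolynomial (Fin n) ℂ)).take i) =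
      Ideal.span ((fun j => (X j - C (p j) : MvPolynomial (Fin n) ℂ)) '' {j : Fin n | j.1 < i}) := by
    unfold Ideal.ofList
    congr 1
    ext r
    simp only [Set.mem_ofPred_eq, List.mem_take_iff_getElem, List.length_ofFn, List.getElem_ofFn,
      Set.mem_image]
    constructor
    · rintro ⟨j, hj, rfl⟩
      exact ⟨⟨j, by omega⟩, by simp; omega, rfl⟩
    · rintro ⟨j, hj, rfl⟩
      exact ⟨j, by have := j.2; omega, rfl⟩
  rw [hid, smul_eq_mul, Ideal.mul_top]
  set S : Set (Fin n) := {j : Fin n | j.1 < i}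
  set I := Ideal.span ((fun j => (X j - C (p j) : MvPolynomial (Fin n) ℂ)) '' S)
  simp only [List.getElem_ofFn]
  rw [isSMulRegular_iff_right_eq_zero_of_smul]
  intro a ha
  obtain ⟨a, rfl⟩ := Ideal.Quotient.mk_surjective a
  set φ : MvPolynomial (Fin n) ℂ →ₐ[ℂ] MvPolynomial (Fin n) ℂ :=
    (aeval (fun j => if j ∈ S then C (p j) else X j : Fin n → MvPolynomial (Fin n) ℂ)) with hφ
  have hφI : ∀ b ∈ I, φ b = 0 := by
    intro b hb
    have : I ≤ RingHom.ker φ.toRingHom := by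
      rw [Ideal.span_le]
      rintro _ ⟨j, hj, rfl⟩
      simp only [SetLike.mem_coe, RingHom.mem_ker]
      change φ _ = 0
      rw [map_sub, aeval_X, if_pos hj, algHom_C, sub_eq_zero]
      rfl
    exact this hb
  have h1 : (X ⟨i, hi'⟩ - C (p ⟨i, hi'⟩)) * a ∈ I := Ideal.Quotient.eq_zero_iff_mem.1 ha
  have h2 := hφI _ h1
  rw [map_mul, map_sub, aeval_X, if_neg (by simp [S]), algHom_C] at h2
  have h3 : φ a = 0 := by
    refine (mul_eq_zero.1 h2).resolve_left ?_
    intro h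
    have := congrArg (eval (fun _ => p ⟨i, hi'⟩ + 1)) h
    simp at this
  have h4 := mvpoly_subst_sub_mem p S a
  change a - φ a ∈ I at h4
  rw [h3, sub_zero] at h4
  exact Ideal.Quotient.eq_zero_iff_mem.2 h4

/-- The fiber ideal. -/
noncomputable def fibI {n : ℕ} (F : Fin n → MvPolynomial (Fin n) ℂ) (w : Fin n → ℂ) :
    Ideal (MvPolynomial (Fin n) ℂ) := Ideal.span (Set.range fun i => F i - C (w i))

noncomputable def fibJ {n : ℕ} (F : Fin n → MvPolynomial (Fin n) ℂ) (w : Fin n → ℂ) (i : Fin n) :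
    Ideal (MvPolynomial (Fin n) ℂ) := Ideal.span ((fun j => F j - C (w j)) '' {j | j ≠ i})

lemma fib_quot_finite {n : ℕ} (F : Fin n → MvPolynomial (Fin n) ℂ)
    (hfin : (aeval F : MvPolynomial (Fin n) ℂ →ₐ[ℂ] MvPolynomial (Fin n) ℂ).toRingHom.Finite)
    (w : Fin n → ℂ) : Module.Finite ℂ (MvPolynomial (Fin n) ℂ ⧸ fibI F w) := by
  have h1 : ((Ideal.Quotient.mk (fibI F w)).comp
      (aeval F : MvPolynomial (Fin n) ℂ →ₐ[ℂ] MvPolynomial (Fin n) ℂ).toRingHom).Finite :=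
    (RingHom.Finite.of_surjective _ Ideal.Quotient.mk_surjective).comp hfin
  have h2 : (Ideal.Quotient.mk (fibI F w)).comp
      (aeval F : MvPolynomial (Fin n) ℂ →ₐ[ℂ] MvPolynomial (Fin n) ℂ).toRingHom =
      (algebraMap ℂ (MvPolynomial (Fin n) ℂ ⧸ fibI F w)).comp (eval w) := by
    apply MvPolynomial.ringHom_ext
    · intro r
      simp
      rfl
    · intro i
      simp only [RingHom.comp_apply, eval_X]
      change Ideal.Quotient.mk _ (aeval F (X i)) = Ideal.Quotient.mk _ (C (w i))
      rw [aeval_X, Ideal.Quotient.eq]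
      exact Ideal.subset_span ⟨i, rfl⟩
  rw [h2] at h1
  exact RingHom.finite_algebraMap.1 (RingHom.Finite.of_comp_finite h1)

lemma fibJ_quot_finite {n : ℕ} (F : Fin n → MvPolynomial (Fin n) ℂ)
    (hfin : (aeval F : MvPolynomial (Fin n) ℂ →ₐ[ℂ] MvPolynomial (Fin n) ℂ).toRingHom.Finite)
    (w : Fin n → ℂ) (i : Fin n) :
    (Polynomial.aeval (Ideal.Quotient.mk (fibJ F w i) (F i)) :
      Polynomial ℂ →ₐ[ℂ] (MvPolynomial (Fin n) ℂ ⧸ fibJ F w i)).toRingHom.Finite := by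
  have h1 : ((Ideal.Quotient.mk (fibJ F w i)).comp
      (aeval F : MvPolynomial (Fin n) ℂ →ₐ[ℂ] MvPolynomial (Fin n) ℂ).toRingHom).Finite :=
    (RingHom.Finite.of_surjective _ Ideal.Quotient.mk_surjective).comp hfin
  have h2 : (Ideal.Quotient.mk (fibJ F w i)).comp
      (aeval F : MvPolynomial (Fin n) ℂ →ₐ[ℂ] MvPolynomial (Fin n) ℂ).toRingHom =
      (Polynomial.aeval (Ideal.Quotient.mk (fibJ F w i) (F i)) :
      Polynomial ℂ →ₐ[ℂ] (MvPolynomial (Fin n) ℂ ⧸ fibJ F w i)).toRingHom.comp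
      (aeval (fun j => if j = i then Polynomial.X else Polynomial.C (w j) : Fin n → Polynomial ℂ) :
        MvPolynomial (Fin n) ℂ →ₐ[ℂ] Polynomial ℂ).toRingHom := by
    apply MvPolynomial.ringHom_ext
    · intro r
      simp
      rfl
    · intro j
      simp only [RingHom.comp_apply]
      change Ideal.Quotient.mk _ (aeval F (X j)) = Polynomial.aeval _ (aeval _ (X j))
      rw [aeval_X, aeval_X]
      split_ifs with h
      · simp [h]
      · rw [Polynomial.aeval_C]
        change Ideal.Quotient.mk _ (F j) = Ideal.Quotient.mk _ (C (w j))
        rw [Ideal.Quotient.eq]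
        exact Ideal.subset_span ⟨j, h, rfl⟩
  rw [h2] at h1
  exact RingHom.Finite.of_comp_finite h1

lemma fibJ_nzd {n : ℕ} (F : Fin n → MvPolynomial (Fin n) ℂ)
    (hfin : (aeval F : MvPolynomial (Fin n) ℂ →ₐ[ℂ] MvPolynomial (Fin n) ℂ).toRingHom.Finite)
    (w : Fin n → ℂ) (i : Fin n) (c : ℂ) (a : MvPolynomial (Fin n) ℂ)
    (h : (F i - C c) * a ∈ fibJ F w i) : a ∈ fibJ F w i := by
  classical
  by_contra ha
  let K : Ideal (MvPolynomial (Fin n) ℂ) :=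
    Submodule.comap (LinearMap.toSpanSingleton (MvPolynomial (Fin n) ℂ) _ a) (fibJ F w i)
  have hK : ∀ s, s ∈ K ↔ s * a ∈ fibJ F w i := fun s => Iff.rfl
  have hKt : K ≠ ⊤ := by
    intro h
    apply ha
    have : (1 : MvPolynomial (Fin n) ℂ) ∈ K := h ▸ trivial
    simpa [hK] using this
  obtain ⟨m, hm, hKm⟩ := Ideal.exists_le_maximal K hKt
  obtain ⟨p, hp⟩ := MvPolynomial.isMaximal_iff_eq_vanishingIdeal_singleton.1 hm
  have hmem : ∀ g, g ∈ m ↔ eval p g = 0 := by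
    intro g
    rw [hp, mem_vanishingIdeal_singleton_iff, aeval_eq_eval]
  have hJm : fibJ F w i ≤ m := fun s hs => hKm ((hK s).2 (Ideal.mul_mem_right _ _ hs))
  have hcm : F i - C c ∈ m := hKm ((hK _).2 h)
  set R := Localization.AtPrime m
  set al := algebraMap (MvPolynomial (Fin n) ℂ) R
  set w' := Function.update w i c
  set xs := List.ofFn fun j => (X j - C (p j) : MvPolynomial (Fin n) ℂ) with hxs
  set fs := (Finset.univ.erase i).toList.map (fun j => F j - C (w j)) with hfs
  have hfsJ : Ideal.ofList fs = fibJ F w i := by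
    unfold Ideal.ofList fibJ
    congr 1
    ext r
    simp [hfs]
  have hxm : ∀ r ∈ xs, r ∈ m := by
    intro r hr
    rw [hxs, List.mem_ofFn] at hr
    obtain ⟨j, rfl⟩ := hr
    simp [hmem]
  have hfm : ∀ r ∈ fs ++ [F i - C c], r ∈ m := by
    intro r hr
    rw [List.mem_append, List.mem_singleton] at hr
    rcases hr with hr | rfl
    · exact hJm (hfsJ ▸ Ideal.subset_span hr)
    · exact hcm
  have hto : ∀ r, r ∈ m → al r ∈ IsLocalRing.maximalIdeal R := by
    intro r hr
    rw [← IsLocalization.AtPrime.map_eq_maximalIdeal m R]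
    exact Ideal.mem_map_of_mem _ hr
  have hflat : Module.Flat (MvPolynomial (Fin n) ℂ) R := IsLocalization.flat R m.primeCompl
  have hreg := IsWeaklyRegular.of_flat (S := R) (mvpoly_coord_regular p)
  -- primes of R that come from m
  have hprime : ∀ (P : Ideal R), P.IsPrime → (P.comap al = m) → P = IsLocalRing.maximalIdeal R := by
    intro P hP h
    refine le_antisymm (IsLocalRing.le_maximalIdeal hP.ne_top) ?_
    rw [← IsLocalization.AtPrime.map_eq_maximalIdeal m R, Ideal.map_le_iff_le_comap]
    exact h.ge
  have hcomap_le : ∀ (P : Ideal R), P.IsPrime → P.comap al ≤ m := by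
    intro P hP x hx
    by_contra hxm
    exact hP.ne_top (Ideal.eq_top_of_isUnit_mem _ hx
      (IsLocalization.map_units R (⟨x, hxm⟩ : m.primeCompl)))
  have hmain := cm_main (R := R) n R (xs.map al) ((fs ++ [F i - C c]).map al)
    (by simp [hxs]) (by simp [hfs]; have := i.2; omega)
    (by
      intro r hr
      obtain ⟨s, hs, rfl⟩ := List.mem_map.1 hr
      exact hto s (hxm s hs))
    (by
      intro r hr
      obtain ⟨s, hs, rfl⟩ := List.mem_map.1 hr
      exact hto s (hfm s hs))
    (by
      intro P hP hle
      apply hprime P hP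
      refine le_antisymm (hcomap_le P hP) ?_
      intro g hg
      have h1 := mvpoly_subst_sub_mem p Set.univ g
      simp only [Set.mem_univ, if_true] at h1
      have h2 : aeval (fun j => C (p j) : Fin n → MvPolynomial (Fin n) ℂ) g = C (eval p g) := by
        have : (aeval (fun j => C (p j) : Fin n → MvPolynomial (Fin n) ℂ)) =
          (Algebra.ofId ℂ (MvPolynomial (Fin n) ℂ)).comp (aeval p) := by
          apply MvPolynomial.algHom_ext
          intro j
          simp [Algebra.ofId_apply]
        rw [this]
        simp [Algebra.ofId_apply, aeval_eq_eval]
      rw [h2, (hmem g).1 hg, map_zero, sub_zero] at h1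
      refine (Ideal.span_le.2 ?_ : _ ≤ P.comap al) h1
      rintro _ ⟨j, -, rfl⟩
      apply hle
      apply Ideal.mem_sup_right
      apply Ideal.subset_span
      exact List.mem_map_of_mem (List.mem_ofFn.2 ⟨j, rfl⟩))
    (by
      intro P hP hle
      apply hprime P hP
      have hfin' := fib_quot_finite F hfin w'
      have hQ : (P.comap al).IsPrime := hP.comap al
      have hIQ : fibI F w' ≤ P.comap al := by
        unfold fibI
        rw [Ideal.span_le]
        rintro _ ⟨j, rfl⟩
        apply hle
        apply Ideal.mem_sup_right
        apply Ideal.subset_span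
        apply List.mem_map_of_mem
        by_cases hj : j = i
        · subst hj; simp [w']
        · simp [w', hj, hfs]
          exact Or.inl ⟨j, hj, rfl⟩
      have hart : IsArtinianRing (MvPolynomial (Fin n) ℂ ⧸ fibI F w') :=
        IsArtinianRing.of_finite ℂ _
      have hp2 : ((P.comap al).map (Ideal.Quotient.mk (fibI F w'))).IsPrime :=
        Ideal.isPrime_map_quotientMk_of_isPrime hIQ
      have hmax := hp2.isMaximal'
      have : (P.comap al).IsMaximal := by
        have := Ideal.comap_isMaximal_of_surjective (Ideal.Quotient.mk (fibI F w'))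
          Ideal.Quotient.mk_surjective (K := (P.comap al).map (Ideal.Quotient.mk (fibI F w')))
        rwa [Ideal.comap_map_of_surjective _ Ideal.Quotient.mk_surjective,
          ← RingHom.ker_eq_comap_bot, Ideal.mk_ker, sup_eq_left.2 hIQ] at this
      exact this.eq_of_le hm.ne_top (hcomap_le P hP))
    hreg
  rw [List.map_append, isWeaklyRegular_append_iff, List.map_singleton,
    isWeaklyRegular_singleton_iff, smul_eq_mul, Ideal.mul_top] at hmain
  have h2 := hmain.2
  rw [isSMulRegular_iff_right_eq_zero_of_smul] at h2
  have hJmap : Ideal.ofList (fs.map al) = (fibJ F w i).map al := by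
    rw [← hfsJ, Ideal.map_ofList]
  have h3 := h2 (Ideal.Quotient.mk _ (al a)) (by
    change Ideal.Quotient.mk _ (al (F i - C c) * al a) = 0
    rw [Ideal.Quotient.eq_zero_iff_mem, hJmap, ← map_mul]
    exact Ideal.mem_map_of_mem _ h)
  rw [Ideal.Quotient.eq_zero_iff_mem, hJmap,
    IsLocalization.algebraMap_mem_map_algebraMap_iff m.primeCompl] at h3
  obtain ⟨s, hs, hsa⟩ := h3
  exact hs (hKm ((hK s).2 hsa))

lemma fib_finrank_update {n : ℕ} (F : Fin n → MvPolynomial (Fin n) ℂ)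
    (hfin : (aeval F : MvPolynomial (Fin n) ℂ →ₐ[ℂ] MvPolynomial (Fin n) ℂ).toRingHom.Finite)
    (w : Fin n → ℂ) (i : Fin n) (c c' : ℂ) :
    Module.finrank ℂ (MvPolynomial (Fin n) ℂ ⧸ fibI F (Function.update w i c)) =
    Module.finrank ℂ (MvPolynomial (Fin n) ℂ ⧸ fibI F (Function.update w i c')) := by
  obtain ⟨r, hr⟩ := finrank_const (Ideal.Quotient.mk (fibJ F w i) (F i))
    (fibJ_quot_finite F hfin w i) (by
      intro c a h
      obtain ⟨a, rfl⟩ := Ideal.Quotient.mk_surjective a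
      rw [Ideal.Quotient.eq_zero_iff_mem]
      apply fibJ_nzd F hfin w i c
      rw [← Ideal.Quotient.eq_zero_iff_mem, map_mul, map_sub]
      exact h)
  have key : ∀ c, Module.finrank ℂ (MvPolynomial (Fin n) ℂ ⧸ fibI F (Function.update w i c)) = r := by
    intro c
    rw [← hr c]
    have hI : fibI F (Function.update w i c) = fibJ F w i ⊔ Ideal.span {F i - C c} := by
      unfold fibI fibJ
      rw [← Ideal.span_union]
      congr 1
      ext g
      simp only [Set.mem_range, Set.mem_union, Set.mem_image, Set.mem_singleton_iff,
        Set.mem_ofPred_eq]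
      constructor
      · rintro ⟨j, rfl⟩
        by_cases hj : j = i
        · subst hj; right; simp
        · left; exact ⟨j, hj, by simp [hj]⟩
      · rintro (⟨j, hj, rfl⟩ | rfl)
        · exact ⟨j, by simp [hj]⟩
        · exact ⟨i, by simp⟩
    have e := DoubleQuot.quotQuotEquivQuotSupₐ ℂ (fibJ F w i) (Ideal.span {F i - C c})
    rw [hI, ← e.toLinearEquiv.finrank_eq]
    have h2 : (Ideal.span {F i - C c}).map (Ideal.Quotient.mkₐ ℂ (fibJ F w i)) =
        Ideal.span {Ideal.Quotient.mk (fibJ F w i) (F i) -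
          algebraMap ℂ (MvPolynomial (Fin n) ℂ ⧸ fibJ F w i) c} := by
      rw [Ideal.map_span, Set.image_singleton, map_sub]
      rfl
    exact (Ideal.quotientEquivAlgOfEq ℂ h2).toLinearEquiv.finrank_eq
  rw [key, key]

lemma fib_finrank {n : ℕ} (F : Fin n → MvPolynomial (Fin n) ℂ)
    (hfin : (aeval F : MvPolynomial (Fin n) ℂ →ₐ[ℂ] MvPolynomial (Fin n) ℂ).toRingHom.Finite)
    (w : Fin n → ℂ) :
    Module.finrank ℂ (MvPolynomial (Fin n) ℂ ⧸ fibI F w) =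
    Module.finrank ℂ (MvPolynomial (Fin n) ℂ ⧸ fibI F 0) := by
  classical
  have : ∀ s : Finset (Fin n), Module.finrank ℂ (MvPolynomial (Fin n) ℂ ⧸
      fibI F (fun j => if j ∈ s then w j else 0)) =
      Module.finrank ℂ (MvPolynomial (Fin n) ℂ ⧸ fibI F 0) := by
    intro s
    induction s using Finset.induction_on with
    | empty => simp; rfl
    | insert i s hi ih =>
      rw [← ih]
      have h1 : (fun j => if j ∈ insert i s then w j else 0) =
          Function.update (fun j => if j ∈ s then w j else 0) i (w i) := by
        ext j
        by_cases hj : j = i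
        · subst hj; simp
        · simp [hj]
      have h2 : (fun j => if j ∈ s then w j else 0) =
          Function.update (fun j => if j ∈ s then w j else 0) i 0 := by
        ext j
        by_cases hj : j = i
        · subst hj; simp [hi]
        · simp [hj]
      rw [h1]
      conv_rhs => rw [h2]
      exact fib_finrank_update F hfin _ i _ _
  have h := this Finset.univ
  have hw : (fun j => if j ∈ Finset.univ then w j else 0) = w := by ext j; simp
  rw [hw] at h
  exact h


noncomputable def ptI {n : ℕ} (p : Fin n → ℂ) : Ideal (MvPolynomial (Fin n) ℂ) :=
  RingHom.ker (eval p)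

lemma mem_ptI {n : ℕ} (p : Fin n → ℂ) (g : MvPolynomial (Fin n) ℂ) :
    g ∈ ptI p ↔ eval p g = 0 := Iff.rfl

lemma taylor_ptI {n : ℕ} (p : Fin n → ℂ) (g : MvPolynomial (Fin n) ℂ) :
    g - C (eval p g) - ∑ j, C (eval p (pderiv j g)) * (X j - C (p j)) ∈ ptI p * ptI p := by
  induction g using MvPolynomial.induction_on with
  | C a => simp
  | add g h hg hh =>
    have := Ideal.add_mem _ hg hh
    convert this using 1
    simp only [map_add, add_mul, Finset.sum_add_distrib]
    ring
  | mul_X g k hg =>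
    have h1 : (g - C (eval p g)) * (X k - C (p k)) ∈ ptI p * ptI p :=
      Ideal.mul_mem_mul (by simp [mem_ptI]) (by simp [mem_ptI])
    have := Ideal.add_mem _ h1 (Ideal.mul_mem_left _ (C (p k)) hg)
    convert this using 1
    have hs : ∑ j, C (eval p (pderiv j (g * X k))) * (X j - C (p j)) =
        C (p k) * ∑ j, C (eval p (pderiv j g)) * (X j - C (p j)) +
        C (eval p g) * (X k - C (p k)) := by
      rw [Finset.mul_sum]
      have : C (eval p g) * (X k - C (p k)) =
          ∑ j, if j = k then C (eval p g) * (X j - C (p j)) else 0 := by simp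
      rw [this, ← Finset.sum_add_distrib]
      apply Finset.sum_congr rfl
      intro j _
      rw [Derivation.leibniz, pderiv_X]
      by_cases hj : j = k
      · subst hj
        simp
        ring
      · simp [hj, Ne.symm hj]
        ring
    rw [hs]
    simp only [map_mul, eval_X]
    ring

lemma ptI_eq_span {n : ℕ} (p : Fin n → ℂ) :
    ptI p ≤ Ideal.span (Set.range fun j => (X j - C (p j) : MvPolynomial (Fin n) ℂ)) := by
  intro g hg
  have : ∀ g : MvPolynomial (Fin n) ℂ, g - C (eval p g) ∈
      Ideal.span (Set.range fun j => (X j - C (p j) : MvPolynomial (Fin n) ℂ)) := by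
    intro g
    induction g using MvPolynomial.induction_on with
    | C a => simp
    | add g h hg hh =>
      convert Ideal.add_mem _ hg hh using 1
      simp only [map_add]; ring
    | mul_X g k hg =>
      have h1 : g * (X k - C (p k)) ∈
        Ideal.span (Set.range fun j => (X j - C (p j) : MvPolynomial (Fin n) ℂ)) :=
        Ideal.mul_mem_left _ _ (Ideal.subset_span ⟨k, rfl⟩)
      convert Ideal.add_mem _ h1 (Ideal.mul_mem_left _ (C (p k)) hg) using 1
      simp only [map_mul, eval_X]
      ring
  have h := this g
  rwa [(mem_ptI p g).1 hg, map_zero, sub_zero] at h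

lemma fib_nakayama {n : ℕ} (F : Fin n → MvPolynomial (Fin n) ℂ) (w p : Fin n → ℂ)
    (hp : ∀ i, eval p (F i) = w i)
    (hdet : (Matrix.of fun i j : Fin n => eval p (pderiv i (F j))).det ≠ 0) :
    ∃ r, eval p r = 1 ∧ ∀ g ∈ ptI p, r * g ∈ fibI F w := by
  set M := (Matrix.of fun i j : Fin n => eval p (pderiv i (F j))) with hM
  have hMN : M * M⁻¹ = 1 := Matrix.mul_nonsing_inv _ (isUnit_iff_ne_zero.2 hdet)
  have hle : ptI p ≤ fibI F w ⊔ ptI p • ptI p := by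
    refine (ptI_eq_span p).trans ?_
    rw [Ideal.span_le]
    rintro _ ⟨k, rfl⟩
    have h1 : ∑ j, C (M⁻¹ j k) * (F j - C (w j)) ∈ fibI F w :=
      Ideal.sum_mem _ fun j _ => Ideal.mul_mem_left _ _ (Ideal.subset_span ⟨j, rfl⟩)
    have h2 : ∑ j, C (M⁻¹ j k) * (F j - C (eval p (F j)) -
        ∑ i, C (eval p (pderiv i (F j))) * (X i - C (p i))) ∈ ptI p * ptI p :=
      Ideal.sum_mem _ fun j _ => Ideal.mul_mem_left _ _ (taylor_ptI p (F j))
    have h3 : (X k - C (p k) : MvPolynomial (Fin n) ℂ) = ∑ j, C (M⁻¹ j k) * (F j - C (w j)) -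
        ∑ j, C (M⁻¹ j k) * (F j - C (eval p (F j)) -
        ∑ i, C (eval p (pderiv i (F j))) * (X i - C (p i))) := by
      simp only [hp]
      rw [← Finset.sum_sub_distrib]
      simp only [← mul_sub, sub_sub_cancel, Finset.mul_sum]
      rw [Finset.sum_comm]
      have : ∀ i, ∑ j, C (M⁻¹ j k) * (C (eval p (pderiv i (F j))) * (X i - C (p i))) =
          C ((M * M⁻¹) i k) * (X i - C (p i) : MvPolynomial (Fin n) ℂ) := by
        intro i
        rw [Matrix.mul_apply, map_sum, Finset.sum_mul]
        apply Finset.sum_congr rfl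
        intro j _
        simp only [hM, Matrix.of_apply, map_mul]
        ring
      simp only [this, hMN, Matrix.one_apply]
      simp
    change X k - C (p k) ∈ _
    rw [h3]
    exact Ideal.sub_mem _ (Ideal.mem_sup_left h1) (Ideal.mem_sup_right h2)
  obtain ⟨r, hr, hr2⟩ := Submodule.exists_sub_one_mem_and_smul_le_of_fg_of_le_sup
    ((isNoetherianRing_iff_ideal_fg _).1 inferInstance (ptI p)) le_rfl hle
  refine ⟨r, ?_, fun g hg => hr2 (Submodule.smul_mem_pointwise_smul _ _ _ hg)⟩
  rw [mem_ptI, map_sub, map_one, sub_eq_zero] at hr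
  exact hr

lemma fib_radical {n : ℕ} (F : Fin n → MvPolynomial (Fin n) ℂ) (w : Fin n → ℂ)
    (hdet : ∀ p, (∀ i, eval p (F i) = w i) →
      (Matrix.of fun i j : Fin n => eval p (pderiv i (F j))).det ≠ 0)
    (g : MvPolynomial (Fin n) ℂ) (hg : ∀ p, (∀ i, eval p (F i) = w i) → eval p g = 0) :
    g ∈ fibI F w := by
  by_contra ha
  let K : Ideal (MvPolynomial (Fin n) ℂ) :=
    Submodule.comap (LinearMap.toSpanSingleton (MvPolynomial (Fin n) ℂ) _ g) (fibI F w)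
  have hK : ∀ s, s ∈ K ↔ s * g ∈ fibI F w := fun s => Iff.rfl
  have hKt : K ≠ ⊤ := by
    intro h
    apply ha
    have : (1 : MvPolynomial (Fin n) ℂ) ∈ K := h ▸ trivial
    simpa [hK] using this
  obtain ⟨m, hm, hKm⟩ := Ideal.exists_le_maximal K hKt
  obtain ⟨p, hp⟩ := MvPolynomial.isMaximal_iff_eq_vanishingIdeal_singleton.1 hm
  have hmem : ∀ g, g ∈ m ↔ eval p g = 0 := by
    intro g
    rw [hp, mem_vanishingIdeal_singleton_iff, aeval_eq_eval]
  have hpF : ∀ i, eval p (F i) = w i := by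
    intro i
    have : F i - C (w i) ∈ m := hKm ((hK _).2 (Ideal.mul_mem_right _ _ (Ideal.subset_span ⟨i, rfl⟩)))
    rw [hmem, map_sub, eval_C, sub_eq_zero] at this
    exact this
  obtain ⟨r, hr, hr2⟩ := fib_nakayama F w p hpF (hdet p hpF)
  have := (hmem r).1 (hKm ((hK r).2 (hr2 g (hg p hpF))))
  rw [hr] at this
  exact one_ne_zero this

lemma interp {n : ℕ} (T : Finset (Fin n → ℂ)) (v : (Fin n → ℂ) → ℂ) :
    ∃ g : MvPolynomial (Fin n) ℂ, ∀ p ∈ T, eval p g = v p := by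
  classical
  have h1 : ∀ p q : Fin n → ℂ, ∃ l : MvPolynomial (Fin n) ℂ,
      p ≠ q → eval p l = 1 ∧ eval q l = 0 := by
    intro p q
    by_cases h : p = q
    · exact ⟨0, fun h' => absurd h h'⟩
    · obtain ⟨j, hj⟩ := Function.ne_iff.1 h
      refine ⟨C (p j - q j)⁻¹ * (X j - C (q j)), fun _ => ⟨?_, by simp⟩⟩
      simp only [map_mul, eval_C, map_sub, eval_X]
      exact inv_mul_cancel₀ (sub_ne_zero.2 hj)
  choose l hl using h1
  refine ⟨∑ p ∈ T, C (v p) * ∏ q ∈ T.erase p, l p q, fun p hp => ?_⟩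
  rw [map_sum, Finset.sum_eq_single p]
  · rw [map_mul, eval_C, map_prod, Finset.prod_eq_one, mul_one]
    intro q hq
    exact (hl p q (Finset.ne_of_mem_erase hq).symm).1
  · intro q hq hqp
    rw [map_mul, map_prod, Finset.prod_eq_zero (Finset.mem_erase.2 ⟨hqp.symm, hp⟩) (hl q p hqp).2,
      mul_zero]
  · exact fun h => absurd hp h

lemma fib_card {n : ℕ} (F : Fin n → MvPolynomial (Fin n) ℂ)
    (hfin : (aeval F : MvPolynomial (Fin n) ℂ →ₐ[ℂ] MvPolynomial (Fin n) ℂ).toRingHom.Finite)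
    (w : Fin n → ℂ)
    (hdet : ∀ p, (∀ i, eval p (F i) = w i) →
      (Matrix.of fun i j : Fin n => eval p (pderiv i (F j))).det ≠ 0) :
    ∃ T : Finset (Fin n → ℂ), (∀ p, p ∈ T ↔ ∀ i, eval p (F i) = w i) ∧
      T.card = Module.finrank ℂ (MvPolynomial (Fin n) ℂ ⧸ fibI F w) := by
  classical
  have := fib_quot_finite F hfin w
  let ev : (T : Finset (Fin n → ℂ)) → MvPolynomial (Fin n) ℂ →ₗ[ℂ] (T → ℂ) := fun T =>
    LinearMap.pi fun p => (aeval p.1 : MvPolynomial (Fin n) ℂ →ₐ[ℂ] ℂ).toLinearMap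
  have hev : ∀ T g p, ev T g p = eval p.1 g := fun T g p => by
    simp [ev, aeval_eq_eval]
  have hsurj : ∀ T, Function.Surjective (ev T) := by
    intro T v
    obtain ⟨g, hg⟩ := interp T (fun p => if h : p ∈ T then v ⟨p, h⟩ else 0)
    refine ⟨g, ?_⟩
    ext p
    rw [hev, hg p.1 p.2]
    simp
  have hle : ∀ T : Finset (Fin n → ℂ), (∀ p ∈ T, ∀ i, eval p (F i) = w i) →
      (fibI F w).restrictScalars ℂ ≤ LinearMap.ker (ev T) := by
    intro T hT g hg
    rw [Submodule.restrictScalars_mem] at hg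
    rw [LinearMap.mem_ker]
    ext p
    rw [hev]
    have : fibI F w ≤ ptI p.1 := by
      unfold fibI
      rw [Ideal.span_le]
      rintro _ ⟨i, rfl⟩
      simp [mem_ptI, hT p.1 p.2]
    exact this hg
  let e2 : (MvPolynomial (Fin n) ℂ ⧸ fibI F w) ≃ₗ[ℂ]
      (MvPolynomial (Fin n) ℂ ⧸ (fibI F w).restrictScalars ℂ) :=
    (Submodule.Quotient.restrictScalarsEquiv ℂ _).symm
  have hfd : Module.Finite ℂ (MvPolynomial (Fin n) ℂ ⧸ (fibI F w).restrictScalars ℂ) :=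
    Module.Finite.equiv e2
  have hcard : ∀ T : Finset (Fin n → ℂ), (∀ p ∈ T, ∀ i, eval p (F i) = w i) →
      T.card ≤ Module.finrank ℂ (MvPolynomial (Fin n) ℂ ⧸ fibI F w) := by
    intro T hT
    rw [e2.finrank_eq]
    have hs : Function.Surjective (Submodule.liftQ _ (ev T) (hle T hT)) := by
      intro v
      obtain ⟨g, hg⟩ := hsurj T v
      exact ⟨Submodule.Quotient.mk g, by simpa using hg⟩
    have := LinearMap.finrank_le_finrank_of_surjective hs
    simpa using this
  have hVfin : {p : Fin n → ℂ | ∀ i, eval p (F i) = w i}.Finite := by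
    by_contra hinf
    obtain ⟨T, hT, hTc⟩ := Set.Infinite.exists_subset_card_eq hinf
      (Module.finrank ℂ (MvPolynomial (Fin n) ℂ ⧸ fibI F w) + 1)
    have := hcard T (fun p hp => hT hp)
    omega
  refine ⟨hVfin.toFinset, fun p => by simp, ?_⟩
  have hker : LinearMap.ker (ev hVfin.toFinset) = (fibI F w).restrictScalars ℂ := by
    refine le_antisymm ?_ (hle _ (by simp))
    intro g hg
    rw [Submodule.restrictScalars_mem]
    apply fib_radical F w hdet
    intro p hp
    have := congrFun (LinearMap.mem_ker.1 hg) ⟨p, by simpa using hp⟩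
    rwa [hev] at this
  have e := (Submodule.quotEquivOfEq _ _ hker.symm).trans
    ((ev hVfin.toFinset).quotKerEquivOfSurjective (hsurj _))
  rw [(e2.trans e).finrank_eq, Module.finrank_pi]
  simp


lemma ringhom_finite_of {A B : Type*} [CommRing A] [CommRing B] (φ : A →+* B) (s : Set B)
    (hs : s.Finite) (h : ∀ N : AddSubgroup B, s ⊆ N → (∀ a x, x ∈ N → φ a * x ∈ N) → N = ⊤) :
    φ.Finite := by
  letI := φ.toAlgebra
  change Module.Finite A B
  refine ⟨⟨hs.toFinset, ?_⟩⟩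
  rw [hs.coe_toFinset]
  have := h (Submodule.span A s).toAddSubgroup Submodule.subset_span
    (fun a x hx => Submodule.smul_mem _ a hx)
  rw [eq_top_iff]
  intro x _
  have hx : x ∈ (⊤ : AddSubgroup B) := trivial
  rw [← this] at hx
  exact hx

lemma wh_coeffs {n : ℕ} (k : Fin n → ℕ) (D : Fin n → ℕ) (F : Fin n → MvPolynomial (Fin n) ℂ)
    (hD : ∀ i, 0 < D i) (hF : ∀ i, IsWeightedHomogeneous k (F i) (D i))
    (g : MvPolynomial (Fin n) ℂ) (m : ℕ) (hg : IsWeightedHomogeneous k g m)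
    (hgI : g ∈ Ideal.span (Set.range F)) :
    ∃ h : Fin n → MvPolynomial (Fin n) ℂ, g = ∑ j, F j * h j ∧
      ∀ j, ∀ b ∈ (h j).support, Finsupp.weight k b + D j = m := by
  classical
  obtain ⟨c, hc⟩ := Ideal.mem_span_range_iff_exists_fun.1 hgI
  letI := weightedGradedAlgebra ℂ k
  have h1 : ∀ j, weightedHomogeneousComponent k m (F j * c j) =
      if D j ≤ m then F j * weightedHomogeneousComponent k (m - D j) (c j) else 0 := by
    intro j
    have := DirectSum.coe_decompose_mul_of_left_mem (weightedHomogeneousSubmodule ℂ k)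
      (b := c j) m (hF j)
    have hdec : ∀ φ m, ((DirectSum.decompose (weightedHomogeneousSubmodule ℂ k)) φ m :
        MvPolynomial (Fin n) ℂ) = weightedHomogeneousComponent k m φ :=
      fun φ m => weightedDecomposition.decompose'_apply ℂ k φ m
    rw [hdec, hdec] at this
    rw [this]
  refine ⟨fun j => if D j ≤ m then weightedHomogeneousComponent k (m - D j) (c j) else 0, ?_, ?_⟩
  · have h2 : weightedHomogeneousComponent k m g = g := hg.weightedHomogeneousComponent_same
    rw [← h2, ← hc, map_sum]
    apply Finset.sum_congr rfl
    intro j _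
    rw [mul_comm, h1, mul_ite, mul_zero]
  · intro j b hb
    dsimp only at hb
    split_ifs at hb with hj
    · have := weightedHomogeneousComponent_isWeightedHomogeneous (w := k) (m - D j) (c j)
        (mem_support_iff.1 hb)
      omega
    · simp at hb

lemma finite_of_wh {n : ℕ} (k : Fin n → ℕ) (D : Fin n → ℕ) (F : Fin n → MvPolynomial (Fin n) ℂ)
    (hD : ∀ i, 0 < D i) (hF : ∀ i, IsWeightedHomogeneous k (F i) (D i))
    (h0 : ∀ z : Fin n → ℂ, (∀ i, eval z (F i) = 0) → z = 0) :
    (aeval F : MvPolynomial (Fin n) ℂ →ₐ[ℂ] MvPolynomial (Fin n) ℂ).toRingHom.Finite := by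
  classical
  have hrad : ∀ i, ∃ N : ℕ, (X i : MvPolynomial (Fin n) ℂ) ^ N ∈ Ideal.span (Set.range F) := by
    intro i
    rw [← Ideal.mem_radical_iff, ← vanishingIdeal_zeroLocus_eq_radical (K := ℂ),
      mem_vanishingIdeal_iff]
    intro z hz
    rw [zeroLocus_span] at hz
    have : z = 0 := h0 z fun i => by
      have := hz (F i) ⟨i, rfl⟩
      rwa [aeval_eq_eval] at this
    simp [this]
  choose N hN using hrad
  have hH : ∀ i, ∃ h : Fin n → MvPolynomial (Fin n) ℂ, X i ^ N i = ∑ j, F j * h j ∧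
      ∀ j, ∀ b ∈ (h j).support, Finsupp.weight k b + D j = N i * k i := by
    intro i
    apply wh_coeffs k D F hD hF _ _ _ (hN i)
    simpa using (isWeightedHomogeneous_X ℂ k i).pow (N i)
  choose H hH1 hH2 using hH
  refine ringhom_finite_of _ ((fun a : Fin n →₀ ℕ => monomial a (1:ℂ)) '' {a | ∀ i, a i < N i})
    (Set.Finite.image _ ?_) ?_
  · refine (Set.finite_Iic (Finsupp.equivFunOnFinite.symm N)).subset ?_
    intro a ha i
    exact (ha i).le
  · intro S hS hmul
    have hmulF : ∀ j x, x ∈ S → F j * x ∈ S := by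
      intro j x hx
      have := hmul (X j) x hx
      change aeval F (X j) * x ∈ S at this
      rwa [aeval_X] at this
    have hmulC : ∀ c x, x ∈ S → C c * x ∈ S := by
      intro c x hx
      have := hmul (C c) x hx
      change aeval F (C c) * x ∈ S at this
      rwa [algHom_C] at this
    have hmon : ∀ m : ℕ, ∀ a : Fin n →₀ ℕ, Finsupp.weight k a = m → monomial a (1:ℂ) ∈ S := by
      intro m
      induction m using Nat.strong_induction_on with
      | _ m ih =>
        intro a ha
        by_cases hsm : ∀ i, a i < N i
        · exact hS ⟨a, hsm, rfl⟩
        · push Not at hsm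
          obtain ⟨i, hi⟩ := hsm
          have hle : Finsupp.single i (N i) ≤ a := by
            simpa using hi
          obtain ⟨b, rfl⟩ := exists_add_of_le hle
          have h1 : (monomial (Finsupp.single i (N i) + b) (1:ℂ)) =
              X i ^ N i * monomial b 1 := by
            rw [X_pow_eq_monomial, monomial_mul, one_mul]
          rw [h1, hH1, Finset.sum_mul]
          refine S.sum_mem fun j _ => ?_
          rw [mul_assoc]
          apply hmulF
          rw [(H i j).as_sum, Finset.sum_mul]
          refine S.sum_mem fun c hc => ?_
          have h2 : monomial c (coeff c (H i j)) * monomial b (1:ℂ) =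
              C (coeff c (H i j)) * monomial (c + b) 1 := by
            rw [monomial_mul, C_mul_monomial]
          rw [h2]
          apply hmulC
          have h3 := hH2 i j c hc
          have h4 := hD j
          rw [map_add, Finsupp.weight_single] at ha
          rw [smul_eq_mul] at ha
          refine ih (Finsupp.weight k (c + b)) ?_ _ rfl
          rw [map_add]
          omega
    rw [eq_top_iff]
    intro g _
    rw [g.as_sum]
    refine S.sum_mem fun a _ => ?_
    have : monomial a (coeff a g) = C (coeff a g) * monomial a 1 := by
      rw [C_mul_monomial, mul_one]
    rw [this]
    exact hmulC _ _ (hmon _ a rfl)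

lemma coeff_scale {n : ℕ} (k : Fin n → ℕ) (f : MvPolynomial (Fin n) ℂ) (a : Fin n →₀ ℕ) :
    coeff a (aeval (fun i => C ((2:ℂ) ^ k i) * X i : Fin n → MvPolynomial (Fin n) ℂ) f) =
      (2:ℂ) ^ (Finsupp.weight k a) * coeff a f := by
  classical
  induction f using MvPolynomial.induction_on' with
  | monomial u c =>
    have : aeval (fun i => C ((2:ℂ) ^ k i) * X i : Fin n → MvPolynomial (Fin n) ℂ)
        (monomial u c) = C ((2:ℂ) ^ (Finsupp.weight k u)) * monomial u c := by
      rw [aeval_monomial, monomial_eq (s := u) (a := c), algebraMap_eq]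
      simp only [Finsupp.prod, mul_pow, Finset.prod_mul_distrib]
      rw [Finsupp.weight_apply, Finsupp.sum, ← Finset.prod_pow_eq_pow_sum, map_prod]
      have : ∀ i, (C ((2:ℂ) ^ k i) : MvPolynomial (Fin n) ℂ) ^ u i = C ((2:ℂ) ^ (u i • k i)) := by
        intro i
        rw [← map_pow, ← pow_mul, smul_eq_mul, mul_comm]
      simp only [this]
      ring
    rw [this, coeff_C_mul, coeff_monomial]
    split_ifs with h
    · rw [h]
    · simp
  | add p q hp hq => rw [map_add, coeff_add, hp, hq, coeff_add, mul_add]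

lemma qh_weighted {n : ℕ} (f : MvPolynomial (Fin n) ℂ) (d : ℕ) (k : Fin n → ℕ)
    (h : ∀ (lam : ℂ) (z : Fin n → ℂ),
      eval (fun i => lam ^ k i * z i) f = lam ^ d * eval z f) :
    IsWeightedHomogeneous k f d := by
  have h1 : aeval (fun i => C ((2:ℂ) ^ k i) * X i : Fin n → MvPolynomial (Fin n) ℂ) f =
      C ((2:ℂ) ^ d) * f := by
    apply MvPolynomial.funext
    intro z
    rw [map_mul, eval_C, ← h 2 z]
    have : (eval z).comp (aeval (fun i => C ((2:ℂ) ^ k i) * X i :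
        Fin n → MvPolynomial (Fin n) ℂ)).toRingHom = eval (fun i => 2 ^ k i * z i) := by
      apply MvPolynomial.ringHom_ext
      · intro r; simp
      · intro i
        simp
    exact DFunLike.congr_fun this f
  intro a ha
  have h3 := coeff_scale k f a
  rw [h1, coeff_C_mul] at h3
  have h4 := mul_right_cancel₀ ha h3
  have h5 : (2:ℕ) ^ d = 2 ^ (Finsupp.weight k a) := by exact_mod_cast h4
  exact (Nat.pow_right_injective le_rfl h5).symm

lemma wh_eval_scale {n : ℕ} (k : Fin n → ℕ) (f : MvPolynomial (Fin n) ℂ) (m : ℕ)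
    (hf : IsWeightedHomogeneous k f m) (lam : ℂ) (z : Fin n → ℂ) :
    eval (fun i => lam ^ k i * z i) f = lam ^ m * eval z f := by
  rw [eval_eq', eval_eq', Finset.mul_sum]
  refine Finset.sum_congr rfl fun a ha => ?_
  have h1 := hf (mem_support_iff.1 ha)
  rw [Finsupp.weight_apply, Finsupp.sum_fintype _ _ (by simp)] at h1
  rw [← h1, ← Finset.prod_pow_eq_pow_sum]
  simp only [mul_pow, Finset.prod_mul_distrib, smul_eq_mul]
  have : ∀ i, (lam ^ k i) ^ a i = lam ^ (a i * k i) := fun i => by rw [← pow_mul, mul_comm]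
  simp only [this]
  ring

lemma only_zero {n : ℕ} (k D : Fin n → ℕ) (F : Fin n → MvPolynomial (Fin n) ℂ)
    (hk0 : ∀ i, 0 < k i) (hF : ∀ i, IsWeightedHomogeneous k (F i) (D i))
    (h : ∃ ε : ℝ, 0 < ε ∧ ∀ z : Fin n → ℂ, (∀ i, ‖z i‖ < ε) →
      (∀ i, eval z (F i) = 0) → z = 0)
    (z : Fin n → ℂ) (hz : ∀ i, eval z (F i) = 0) : z = 0 := by
  obtain ⟨ε, hε, h⟩ := h
  have hB : 0 < ‖z‖ + 1 := by positivity
  set r : ℝ := min 1 (ε / (2 * (‖z‖ + 1))) with hr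
  have hr0 : 0 < r := lt_min one_pos (by positivity)
  have hr1 : r ≤ 1 := min_le_left _ _
  have hr2 : r * (‖z‖ + 1) < ε := by
    have : r ≤ ε / (2 * (‖z‖ + 1)) := min_le_right _ _
    rw [le_div_iff₀ (by positivity)] at this
    linarith
  have := h (fun i => (r : ℂ) ^ k i * z i) ?_ ?_
  · funext i
    have h1 := congr_fun this i
    simp only [Pi.zero_apply, mul_eq_zero] at h1
    rcases h1 with h1 | h1
    · exact absurd (pow_eq_zero_iff (hk0 i).ne' |>.1 h1) (by exact_mod_cast hr0.ne')
    · exact h1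
  · intro i
    rw [norm_mul, norm_pow, Complex.norm_real, Real.norm_of_nonneg hr0.le]
    have h1 : r ^ k i ≤ r := pow_le_of_le_one hr0.le hr1 (hk0 i).ne'
    have h2 : ‖z i‖ ≤ ‖z‖ := norm_le_pi_norm z i
    calc r ^ k i * ‖z i‖ ≤ r * (‖z‖ + 1) := by gcongr; linarith
      _ < ε := hr2
  · intro i
    rw [wh_eval_scale k _ _ (hF i), hz, mul_zero]

lemma area_formula {E : Type*} [NormedAddCommGroup E] [NormedSpace ℝ E] [FiniteDimensional ℝ E]
    [MeasurableSpace E] [BorelSpace E] (μ : Measure E) [μ.IsAddHaarMeasure]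
    (f : E → E) (f' : E → E →L[ℝ] E) (hf' : ∀ x, HasStrictFDerivAt f (f' x) x)
    (hc : Continuous fun x => (f' x).det) (N : ℕ)
    (hN : ∀ w, (∀ p, f p = w → (f' p).det ≠ 0) →
      ∃ T : Finset E, (∀ p, p ∈ T ↔ f p = w) ∧ T.card = N)
    (g : E → ENNReal) (hg : Measurable g) :
    ∫⁻ x, ENNReal.ofReal |(f' x).det| * g (f x) ∂μ = N * ∫⁻ w, g w ∂μ := by
  classical
  set U : Set E := {x | (f' x).det ≠ 0} with hU
  have hUo : IsOpen U := isOpen_ne_fun hc continuous_const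
  have hV : ∀ x : E, ∃ V : Set E, IsOpen V ∧ Set.InjOn f V ∧ (x ∈ U → x ∈ V) := by
    intro x
    by_cases hx : x ∈ U
    · have h1 : HasStrictFDerivAt f
        ((ContinuousLinearMap.toContinuousLinearEquivOfDetNeZero (f' x) hx : E ≃L[ℝ] E) :
          E →L[ℝ] E) x := by
        simpa using hf' x
      refine ⟨(h1.toOpenPartialHomeomorph f).source, (h1.toOpenPartialHomeomorph f).open_source,
        ?_, fun _ => h1.mem_toOpenPartialHomeomorph_source⟩
      have := (h1.toOpenPartialHomeomorph f).injOn
      rwa [h1.toOpenPartialHomeomorph_coe] at this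
    · exact ⟨∅, isOpen_empty, Set.injOn_empty f, fun h => absurd h hx⟩
  choose V hVo hVi hVm using hV
  obtain ⟨t, htU, htc, hcov⟩ := TopologicalSpace.countable_cover_nhdsWithin (s := U) (f := V)
    (fun x hx => mem_nhdsWithin_of_mem_nhds ((hVo x).mem_nhds (hVm x hx)))
  obtain ⟨e, he⟩ := Set.countable_iff_exists_subset_range.1 htc
  set P : ℕ → Set E := fun m => disjointed (fun m => V (e m)) m ∩ U with hP
  have hPm : ∀ m, MeasurableSet (P m) := fun m =>
    (MeasurableSet.disjointed (fun i => (hVo (e i)).measurableSet) m).inter hUo.measurableSet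
  have hPd : Pairwise (Function.onFun Disjoint P) := fun i j hij =>
    ((disjoint_disjointed (fun m => V (e m))) hij).mono Set.inter_subset_left Set.inter_subset_left
  have hPU : ⋃ m, P m = U := by
    rw [hP, ← Set.iUnion_inter, iUnion_disjointed, Set.inter_eq_right]
    intro x hx
    obtain ⟨y, hy, hxy⟩ := Set.mem_iUnion₂.1 (hcov hx)
    obtain ⟨m, rfl⟩ := he hy
    exact Set.mem_iUnion.2 ⟨m, hxy⟩
  have hPi : ∀ m, Set.InjOn f (P m) := fun m =>
    (hVi (e m)).mono (Set.inter_subset_left.trans (disjointed_subset _ m))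
  have hfd : ∀ s : Set E, ∀ x ∈ s, HasFDerivWithinAt f (f' x) s x := fun s x _ =>
    (hf' x).hasFDerivAt.hasFDerivWithinAt
  have hsard : μ (f '' Uᶜ) = 0 := by
    apply addHaar_image_eq_zero_of_det_fderivWithin_eq_zero μ (hfd _)
    intro x hx
    simpa [hU] using hx
  have hIm : ∀ m, MeasurableSet (f '' P m) := fun m =>
    measurable_image_of_fderivWithin (hPm m) (hfd _) (hPi m)
  have h1 : ∫⁻ x, ENNReal.ofReal |(f' x).det| * g (f x) ∂μ =
      ∫⁻ x in U, ENNReal.ofReal |(f' x).det| * g (f x) ∂μ := by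
    rw [← lintegral_indicator hUo.measurableSet]
    apply lintegral_congr
    intro x
    by_cases hx : x ∈ U
    · rw [Set.indicator_of_mem hx]
    · rw [Set.indicator_of_notMem hx]
      have : (f' x).det = 0 := by simpa [hU] using hx
      simp [this]
  rw [h1, ← hPU, lintegral_iUnion hPm hPd]
  have h2 : ∀ m, ∫⁻ x in P m, ENNReal.ofReal |(f' x).det| * g (f x) ∂μ =
      ∫⁻ w, (f '' P m).indicator g w ∂μ := by
    intro m
    rw [lintegral_indicator (hIm m),
      lintegral_image_eq_lintegral_abs_det_fderiv_mul μ (hPm m) (hfd _) (hPi m)]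
  simp only [h2]
  rw [← lintegral_tsum (fun m => (hg.indicator (hIm m)).aemeasurable), ← lintegral_const_mul _ hg]
  apply lintegral_congr_ae
  have h3 : ∀ᵐ w ∂μ, w ∉ f '' Uᶜ := by
    rw [ae_iff]
    simp only [not_not]
    exact hsard
  filter_upwards [h3] with w hw
  have hreg : ∀ p, f p = w → p ∈ U := by
    intro p hp
    by_contra hpU
    exact hw ⟨p, hpU, hp⟩
  obtain ⟨T, hT, hTc⟩ := hN w hreg
  have h4 : ∀ m, (f '' P m).indicator g w = ∑ p ∈ T, (P m).indicator (fun _ => g w) p := by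
    intro m
    by_cases hwm : w ∈ f '' P m
    · rw [Set.indicator_of_mem hwm]
      obtain ⟨p, hp, hpw⟩ := hwm
      rw [Finset.sum_eq_single p]
      · rw [Set.indicator_of_mem hp]
      · intro q hq hqp
        apply Set.indicator_of_notMem
        intro hqm
        exact hqp (hPi m hqm hp (by rw [(hT q).1 hq, hpw]))
      · intro h
        exact absurd ((hT p).2 hpw) h
    · rw [Set.indicator_of_notMem hwm, Finset.sum_eq_zero]
      intro q hq
      apply Set.indicator_of_notMem
      intro hqm
      exact hwm ⟨q, hqm, (hT q).1 hq⟩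
  simp only [h4]
  rw [Summable.tsum_finsetSum (fun _ _ => ENNReal.summable)]
  have h5 : ∀ p ∈ T, ∑' m, (P m).indicator (fun _ => g w) p = g w := by
    intro p hp
    have hpU : p ∈ ⋃ m, P m := by rw [hPU]; exact hreg p ((hT p).1 hp)
    obtain ⟨m, hm⟩ := Set.mem_iUnion.1 hpU
    rw [tsum_eq_single m, Set.indicator_of_mem hm]
    intro m' hmm
    apply Set.indicator_of_notMem
    intro h
    exact Set.disjoint_left.1 (hPd hmm) h hm
  rw [Finset.sum_congr rfl h5, Finset.sum_const, hTc, nsmul_eq_mul]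

lemma gauss_int {n : ℕ} (t : ℝ) (ht : 0 < t) :
    ∫ z : Fin n → ℂ, Real.exp (-t * ∑ i, ‖z i‖ ^ 2) = (Real.pi / t) ^ n := by
  have h1 : ∀ z : Fin n → ℂ, Real.exp (-t * ∑ i, ‖z i‖ ^ 2) =
      ∏ i, Real.exp (-t * ‖z i‖ ^ 2) := by
    intro z
    rw [Finset.mul_sum, Real.exp_sum]
  simp only [h1]
  rw [integral_fintype_prod_volume_eq_pow (fun x : ℂ => Real.exp (-t * ‖x‖ ^ 2)),
    GaussianFourier.integral_rexp_neg_mul_sq_norm ht]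
  simp

lemma poly_deriv {n : ℕ} (p : MvPolynomial (Fin n) ℂ) (z : Fin n → ℂ) :
    HasStrictFDerivAt (fun z : Fin n → ℂ => eval z p)
      (∑ i, eval z (pderiv i p) • (ContinuousLinearMap.proj i : (Fin n → ℂ) →L[ℂ] ℂ)) z := by
  induction p using MvPolynomial.induction_on with
  | C a =>
    simp only [eval_C]
    refine (hasStrictFDerivAt_const (𝕜 := ℂ) a z).congr_fderiv ?_
    ext v
    simp
  | add p q hp hq =>
    simp only [map_add]
    refine (hp.add hq).congr_fderiv ?_
    ext v
    simp [add_mul, Finset.sum_add_distrib]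
  | mul_X p j hp =>
    have h1 : HasStrictFDerivAt (fun z : Fin n → ℂ => z j)
      (ContinuousLinearMap.proj j : (Fin n → ℂ) →L[ℂ] ℂ) z :=
      (ContinuousLinearMap.proj j : (Fin n → ℂ) →L[ℂ] ℂ).hasStrictFDerivAt
    have h2 := hp.mul h1
    simp only [map_mul, eval_X]
    refine h2.congr_fderiv ?_
    ext v
    simp [pderiv_X, Pi.single_apply, add_mul, Finset.sum_add_distrib, Finset.mul_sum, mul_assoc,
      apply_ite]

noncomputable def polyD {n : ℕ} (F : Fin n → MvPolynomial (Fin n) ℂ) (z : Fin n → ℂ) :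
    (Fin n → ℂ) →L[ℂ] (Fin n → ℂ) :=
  ContinuousLinearMap.pi fun j =>
    ∑ i, eval z (pderiv i (F j)) • (ContinuousLinearMap.proj i : (Fin n → ℂ) →L[ℂ] ℂ)

lemma polyD_deriv {n : ℕ} (F : Fin n → MvPolynomial (Fin n) ℂ) (z : Fin n → ℂ) :
    HasStrictFDerivAt (fun z : Fin n → ℂ => fun j => eval z (F j)) (polyD F z) z :=
  hasStrictFDerivAt_pi.2 fun j => poly_deriv (F j) z

lemma polyD_det {n : ℕ} (F : Fin n → MvPolynomial (Fin n) ℂ) (z : Fin n → ℂ) :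
    ((polyD F z).restrictScalars ℝ).det =
      ‖(Matrix.of fun i j : Fin n => eval z (pderiv i (F j))).det‖ ^ 2 := by
  have h1 : (polyD F z : (Fin n → ℂ) →ₗ[ℂ] (Fin n → ℂ)) =
      Matrix.toLin' (Matrix.of fun i j : Fin n => eval z (pderiv i (F j))).transpose := by
    ext v j
    simp [polyD, Matrix.mulVec, dotProduct, Pi.single_apply]
  have h2 : (((polyD F z).restrictScalars ℝ : (Fin n → ℂ) →L[ℝ] (Fin n → ℂ)) :
      (Fin n → ℂ) →ₗ[ℝ] (Fin n → ℂ)) =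
      (polyD F z : (Fin n → ℂ) →ₗ[ℂ] (Fin n → ℂ)).restrictScalars ℝ := rfl
  rw [ContinuousLinearMap.det, h2, LinearMap.det_restrictScalars, h1, LinearMap.det_toLin',
    Matrix.det_transpose, Algebra.norm_complex_eq]
  simp [Complex.normSq_eq_norm_sq]

end Aux

lemma main_lint {n : ℕ} (f : MvPolynomial (Fin n) ℂ)
    (d : ℕ) (k : Fin n → ℕ) (hk0 : ∀ i, 0 < k i) (hk1 : ∀ i, k i < d)
    (hQH : IsQuasiHomogeneous f d k) (hnd : Nondegenerate f)
    (g : (Fin n → ℂ) → ENNReal) (hg : Measurable g) :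
    ∫⁻ z : Fin n → ℂ, ENNReal.ofReal
      (‖(Matrix.of fun i j : Fin n => eval z (pderiv i (pderiv j f))).det‖ ^ 2) *
        g (fun i => eval z (pderiv i f)) = (milnorNumber f : ENNReal) * ∫⁻ w, g w := by
  have hwf : IsWeightedHomogeneous k f d := qh_weighted f d k hQH
  set F : Fin n → MvPolynomial (Fin n) ℂ := fun j => pderiv j f with hFdef
  have hF : ∀ j, IsWeightedHomogeneous k (F j) (d - k j) := fun j =>
    hwf.pderiv (Nat.sub_add_cancel (hk1 j).le)
  have h0 := only_zero k _ F hk0 hF hnd.2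
  have hfin := finite_of_wh k _ F (fun i => Nat.sub_pos_of_lt (hk1 i)) hF h0
  have hmil : Module.finrank ℂ (MvPolynomial (Fin n) ℂ ⧸ fibI F 0) = milnorNumber f := by
    have : fibI F 0 = Ideal.span (Set.range fun i => pderiv i f) := by
      simp [fibI, hFdef]
    rw [this, milnorNumber]
  have hdet := fun z => polyD_det F z
  have key := area_formula (volume : Measure (Fin n → ℂ)) (fun z j => eval z (F j))
    (fun z => (polyD F z).restrictScalars ℝ)
    (fun z => (polyD_deriv F z).restrictScalars ℝ) (by
      simp only [hdet]
      refine Continuous.pow (Continuous.norm (Continuous.matrix_det ?_)) 2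
      refine continuous_matrix fun i j => ?_
      exact MvPolynomial.continuous_eval _) (milnorNumber f) (by
      intro w hw
      obtain ⟨T, hT, hTc⟩ := fib_card F hfin w (by
        intro p hp h
        apply hw p (funext hp)
        rw [hdet, h]
        simp)
      refine ⟨T, fun p => (hT p).trans funext_iff.symm, ?_⟩
      rw [hTc, fib_finrank F hfin, hmil]) g hg
  rw [← key]
  apply lintegral_congr
  intro z
  rw [hdet, abs_of_nonneg (by positivity)]

/-- The local index formula: for a nondegenerate quasi-homogeneous `f` with
`q_M − q_m < 1/3`, the Milnor number is given for every `t > 0` by the Gaussian-type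
integral `μ(f) = (tⁿ/πⁿ) ∫_{ℂⁿ} e^{−t|∂f|²} |det ∂²f|² dvol`; in particular
(`f(z) = z²/2`) one recovers `πⁿ = ∫_{ℂⁿ} e^{−|z|²} dvol`. -/
theorem milnor_number_gaussian_integral {n : ℕ} (f : MvPolynomial (Fin n) ℂ)
    (d : ℕ) (k : Fin n → ℕ) (hd : 0 < d) (hk0 : ∀ i, 0 < k i) (hk1 : ∀ i, k i < d)
    (hQH : IsQuasiHomogeneous f d k) (hnd : Nondegenerate f)
    (hgap : ∀ i j, (k i : ℚ) / d - (k j : ℚ) / d < 1 / 3) :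
    (∀ t : ℝ, 0 < t →
      (milnorNumber f : ℝ) = t ^ n / Real.pi ^ n *
        ∫ z : Fin n → ℂ,
          Real.exp (-t * ∑ i, ‖eval z (pderiv i f)‖ ^ 2) *
            ‖(Matrix.of fun i j : Fin n => eval z (pderiv i (pderiv j f))).det‖ ^ 2) ∧
    Real.pi ^ n = ∫ z : Fin n → ℂ, Real.exp (-∑ i, ‖z i‖ ^ 2) := by
  constructor
  · intro t ht
    have hcont : Continuous fun w : Fin n → ℂ => Real.exp (-t * ∑ i, ‖w i‖ ^ 2) := by fun_prop
    have h1 := main_lint f d k hk0 hk1 hQH hnd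
      (fun w => ENNReal.ofReal (Real.exp (-t * ∑ i, ‖w i‖ ^ 2)))
      hcont.measurable.ennreal_ofReal
    have hpc : ∀ p : MvPolynomial (Fin n) ℂ, Continuous fun z : Fin n → ℂ => eval z p :=
      fun p => MvPolynomial.continuous_eval p
    have hcont2 : Continuous fun z : Fin n → ℂ =>
        Real.exp (-t * ∑ i, ‖eval z (pderiv i f)‖ ^ 2) *
          ‖(Matrix.of fun i j : Fin n => eval z (pderiv i (pderiv j f))).det‖ ^ 2 := by
      refine Continuous.mul ?_ (Continuous.pow (Continuous.norm (Continuous.matrix_det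
        (continuous_matrix fun i j => hpc _))) 2)
      refine Real.continuous_exp.comp (continuous_const.mul (continuous_finsetSum _ fun i _ => ?_))
      exact (hpc _).norm.pow 2
    have h2 : ∫ z : Fin n → ℂ,
          Real.exp (-t * ∑ i, ‖eval z (pderiv i f)‖ ^ 2) *
            ‖(Matrix.of fun i j : Fin n => eval z (pderiv i (pderiv j f))).det‖ ^ 2 =
        milnorNumber f * (Real.pi / t) ^ n := by
      rw [← gauss_int t ht, integral_eq_lintegral_of_nonneg_ae
        (Filter.Eventually.of_forall fun z => by positivity) hcont2.aestronglyMeasurable,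
        integral_eq_lintegral_of_nonneg_ae
        (Filter.Eventually.of_forall fun z => by positivity) hcont.aestronglyMeasurable]
      have h3 := congrArg ENNReal.toReal h1
      rw [ENNReal.toReal_mul, ENNReal.toReal_natCast] at h3
      rw [← h3]
      congr 1
      apply lintegral_congr
      intro z
      rw [← ENNReal.ofReal_mul (by positivity), mul_comm]
    rw [h2, div_pow]
    have := Real.pi_pos
    field_simp
  · have := gauss_int (n := n) 1 one_pos
    simpa using this.symm
end

section
/- Let W be a complex vector space of dimension 2n with basis e₁,…,eₙ, ē₁,…,ēₙ, and for a symmetric matrix A ∈ Mat_{n×n}(ℂ) define the endomorphism B of the exterior algebra Λ(W) by B = −∑_{μ,l=1}ⁿ ( A_{μl} · ι_{ē_μ} ∘ (e_l ∧ ·) + \overline{A_{μl}} · ι_{e_μ} ∘ (ē_l ∧ ·) ), where ι_{e_μ} and ι_{ē_μ} denote contraction (interior product) against the dual basis vectors of e_μ and ē_μ respectively. Then for every integer m with 1 ≤ m < 2n, the supertrace str(B^m) = ∑_{k=0}^{2n} (−1)^k tr(B^m|_{Λ^k(W)}) vanishes, and str(B^{2n}) = (−1)ⁿ (2n)! |det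 A|². -/
noncomputable section

/-- The model for `W = ℂ^{2n}` with basis `e₁,…,eₙ, ē₁,…,ēₙ`. -/
abbrev W (n : ℕ) : Type := (Fin n ⊕ Fin n) → ℂ

/-- The basis vector `e_i` (resp. `ē_i` via `Sum.inr`). -/
def e {n : ℕ} (i : Fin n ⊕ Fin n) : W n := Pi.single i 1

/-- Wedging with a vector `w`: the endomorphism `w ∧ ·` of `Λ(W)`. -/
def wedge {n : ℕ} (i : Fin n ⊕ Fin n) :
    ExteriorAlgebra ℂ (W n) →ₗ[ℂ] ExteriorAlgebra ℂ (W n) :=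
  LinearMap.mulLeft ℂ (ExteriorAlgebra.ι ℂ (e i))

/-- Contraction (interior product) against the dual basis vector of `e_i`. -/
def contr {n : ℕ} (i : Fin n ⊕ Fin n) :
    ExteriorAlgebra ℂ (W n) →ₗ[ℂ] ExteriorAlgebra ℂ (W n) :=
  CliffordAlgebra.contractLeft (Q := (0 : QuadraticForm ℂ (W n)))
    (LinearMap.proj i)

/-- The supertrace `str T = ∑_{k} (−1)^k tr (T|_{Λ^k W})`, computed from the
block-diagonal parts of `T` as the trace of `ε ∘ T`, where the grade involution `ε`
acts as `(−1)^k` on `Λ^k(W)`. -/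
def str {n : ℕ} (T : ExteriorAlgebra ℂ (W n) →ₗ[ℂ] ExteriorAlgebra ℂ (W n)) : ℂ :=
  LinearMap.trace ℂ (ExteriorAlgebra ℂ (W n))
    ((CliffordAlgebra.involute (Q := (0 : QuadraticForm ℂ (W n)))).toLinearMap ∘ₗ T)

abbrev EndL (n : ℕ) := Module.End ℂ (ExteriorAlgebra ℂ (W n))

def wv {n : ℕ} (i : Fin n ⊕ Fin n) : EndL n := wedge i

def cv {n : ℕ} (i : Fin n ⊕ Fin n) : EndL n := contr i

def epsOp (n : ℕ) : EndL n :=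
  (CliffordAlgebra.involute (Q := (0 : QuadraticForm ℂ (W n)))).toLinearMap

theorem str_eq {n : ℕ} (T : EndL n) :
    str T = LinearMap.trace ℂ (ExteriorAlgebra ℂ (W n)) (epsOp n * T) := rfl

theorem mneg {n : ℕ} (a b : EndL n) : a * -b = -(a * b) := LinearMap.ext fun x => by
  exact map_neg a (b x)

theorem negm {n : ℕ} (a b : EndL n) : -a * b = -(a * b) := rfl

theorem nneg {n : ℕ} (a : EndL n) : -(-a) = a := LinearMap.ext fun x => neg_neg (a x)

theorem trneg {n : ℕ} (a : EndL n) : LinearMap.trace ℂ (ExteriorAlgebra ℂ (W n)) (-a) =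
    - LinearMap.trace ℂ (ExteriorAlgebra ℂ (W n)) a := map_neg _ a

instance finExt (n : ℕ) : Module.Finite ℂ (ExteriorAlgebra ℂ (W n)) := by
  let b := ((Pi.basisFun ℂ (Fin n ⊕ Fin n)).reindex finSumFinEquiv)
  exact Module.Finite.of_basis b.ExteriorAlgebra

theorem cw {n : ℕ} (i j : Fin n ⊕ Fin n) :
    (cv i : EndL n) * wv j + wv j * cv i = if i = j then 1 else 0 := by
  refine LinearMap.ext fun x => ?_
  change CliffordAlgebra.contractLeft _ (CliffordAlgebra.ι _ (e j) * x)
    + CliffordAlgebra.ι _ (e j) * CliffordAlgebra.contractLeft _ x = _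
  rw [CliffordAlgebra.contractLeft_ι_mul, sub_add_cancel]
  by_cases h : i = j <;> simp [e, h, Pi.single_apply]

theorem ww {n : ℕ} (i j : Fin n ⊕ Fin n) :
    (wv i : EndL n) * wv j = - (wv j * wv i) := by
  rw [eq_neg_iff_add_eq_zero]
  refine LinearMap.ext fun x => ?_
  change ExteriorAlgebra.ι ℂ (e i) * (ExteriorAlgebra.ι ℂ (e j) * x)
    + ExteriorAlgebra.ι ℂ (e j) * (ExteriorAlgebra.ι ℂ (e i) * x) = 0
  rw [← mul_assoc, ← mul_assoc, ← add_mul, ExteriorAlgebra.ι_add_mul_swap, zero_mul]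

theorem cc {n : ℕ} (i j : Fin n ⊕ Fin n) :
    (cv i : EndL n) * cv j = - (cv j * cv i) := by
  refine LinearMap.ext fun x => ?_
  exact CliffordAlgebra.contractLeft_comm (Q := (0 : QuadraticForm ℂ (W n))) _ _ x

theorem ew {n : ℕ} (i : Fin n ⊕ Fin n) :
    wv i * epsOp n = - (epsOp n * wv i) := by
  refine LinearMap.ext fun x => ?_
  change CliffordAlgebra.ι _ (e i) * CliffordAlgebra.involute x
    = - CliffordAlgebra.involute (CliffordAlgebra.ι _ (e i) * x)
  simp

theorem ec {n : ℕ} (i : Fin n ⊕ Fin n) :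
    cv i * epsOp n = - (epsOp n * cv i) := by
  refine LinearMap.ext fun x => ?_
  change CliffordAlgebra.contractLeft (Q := (0 : QuadraticForm ℂ (W n))) (LinearMap.proj i) (CliffordAlgebra.involute x)
    = - CliffordAlgebra.involute (CliffordAlgebra.contractLeft (Q := (0 : QuadraticForm ℂ (W n))) (LinearMap.proj i) x)
  induction x using CliffordAlgebra.left_induction with
  | algebraMap r => simp
  | add x y hx hy => simp only [map_add, hx, hy]; abel
  | ι_mul x m hx =>
    simp [CliffordAlgebra.contractLeft_ι_mul, hx]

theorem str_zero_w {n : ℕ} (i : Fin n ⊕ Fin n) (X : EndL n)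
    (h : X * wv i = wv i * X) : str X = 0 := by
  have h1 : X = X * cv i * wv i + X * wv i * cv i := by
    have := cw i i
    simp only [if_true] at this
    rw [mul_assoc, mul_assoc, ← mul_add, this, mul_one]
  rw [str_eq, h1, mul_add, map_add, ← mul_assoc, LinearMap.trace_mul_comm, h, ← mul_assoc, ew]
  simp only [negm, trneg, mul_assoc, neg_add_cancel]

theorem str_zero_c {n : ℕ} (i : Fin n ⊕ Fin n) (X : EndL n)
    (h : X * cv i = cv i * X) : str X = 0 := by
  have h1 : X = X * wv i * cv i + X * cv i * wv i := by
    have := cw i i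
    simp only [if_true] at this
    rw [mul_assoc, mul_assoc, ← mul_add, add_comm, this, mul_one]
  rw [str_eq, h1, mul_add, map_add, ← mul_assoc, LinearMap.trace_mul_comm, h, ← mul_assoc, ec]
  simp only [negm, trneg, mul_assoc, neg_add_cancel]

def EE {n : ℕ} (i j : Fin n ⊕ Fin n) : EndL n := wv i * cv j

theorem EE_w {n : ℕ} {i j k : Fin n ⊕ Fin n} (h : j ≠ k) :
    EE i j * wv k = wv k * EE i j := by
  have := cw j k
  rw [if_neg h, add_eq_zero_iff_eq_neg] at this
  rw [EE, mul_assoc, this, mneg, ← mul_assoc, ww i k, negm, nneg, mul_assoc]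

theorem EE_c {n : ℕ} {i j k : Fin n ⊕ Fin n} (h : i ≠ k) :
    EE i j * cv k = cv k * EE i j := by
  have := cw k i
  rw [if_neg h.symm, add_eq_zero_iff_eq_neg] at this
  rw [EE, mul_assoc, cc j k, mneg, ← mul_assoc, ← mul_assoc, this, negm]

theorem EE_EE1 {n : ℕ} (i j k l : Fin n ⊕ Fin n) :
    EE i j * EE k l + EE k j * EE i l =
      (if j = k then (1 : ℂ) else 0) • EE i l + (if j = i then (1 : ℂ) else 0) • EE k l := by
  have h1 := eq_sub_of_add_eq (cw j k)
  have h2 := eq_sub_of_add_eq (cw j i)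
  have e1 : ∀ a b c : Fin n ⊕ Fin n, EE a j * EE b c
      = wv a * (cv j * wv b) * cv c := by intros; simp [EE, mul_assoc]
  rw [e1, e1, h1, h2, mul_sub, mul_sub, ← mul_assoc, ← mul_assoc, ww k i]
  have e2 : ∀ (p : Prop) [Decidable p] (a c : Fin n ⊕ Fin n),
    wv a * (if p then 1 else 0) * cv c = (if p then (1 : ℂ) else 0) • EE a c := by
    intro p _ a c; split_ifs <;> simp [EE]
  rw [sub_mul, sub_mul, e2, e2]
  simp only [negm]
  abel

theorem EE_EE2 {n : ℕ} (i j k l : Fin n ⊕ Fin n) :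
    EE i j * EE k l + EE i l * EE k j =
      (if j = k then (1 : ℂ) else 0) • EE i l + (if l = k then (1 : ℂ) else 0) • EE i j := by
  have h1 := eq_sub_of_add_eq (cw j k)
  have h2 := eq_sub_of_add_eq (cw l k)
  have e1 : ∀ b c : Fin n ⊕ Fin n, EE i b * EE k c
      = wv i * (cv b * wv k) * cv c := by intros; simp [EE, mul_assoc]
  rw [e1, e1, h1, h2, mul_sub, mul_sub]
  have e2 : ∀ (p : Prop) [Decidable p] (a c : Fin n ⊕ Fin n),
    wv a * (if p then 1 else 0) * cv c = (if p then (1 : ℂ) else 0) • EE a c := by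
    intro p _ a c; split_ifs <;> simp [EE]
  rw [sub_mul, sub_mul, e2, e2]
  simp only [mul_assoc]
  rw [cc l j]
  simp only [mneg]
  abel

/-- product of a word -/
def wd {n : ℕ} (L : List ((Fin n ⊕ Fin n) × (Fin n ⊕ Fin n))) : EndL n :=
  (L.map fun p => EE p.1 p.2).prod

theorem wd_app {n : ℕ} (L L' : List ((Fin n ⊕ Fin n) × (Fin n ⊕ Fin n))) :
    wd (L ++ L') = wd L * wd L' := by simp [wd]

theorem wd_cons {n : ℕ} (p) (L' : List ((Fin n ⊕ Fin n) × (Fin n ⊕ Fin n))) :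
    wd (p :: L') = EE p.1 p.2 * wd L' := by simp [wd]

theorem list_comm {R : Type*} [Ring R] (L : List R) (x : R) (h : ∀ y ∈ L, y * x = x * y) :
    L.prod * x = x * L.prod :=
  (Commute.list_prod_left L x h : _)

theorem wd_zero1 {n : ℕ} (i) (L : List ((Fin n ⊕ Fin n) × (Fin n ⊕ Fin n)))
    (h : ∀ p ∈ L, p.1 ≠ i) : str (wd L) = 0 := by
  apply str_zero_c i
  apply list_comm
  intro y hy
  obtain ⟨p, hp, rfl⟩ := List.mem_map.1 hy
  exact EE_c (h p hp)

theorem wd_zero2 {n : ℕ} (i) (L : List ((Fin n ⊕ Fin n) × (Fin n ⊕ Fin n)))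
    (h : ∀ p ∈ L, p.2 ≠ i) : str (wd L) = 0 := by
  apply str_zero_w i
  apply list_comm
  intro y hy
  obtain ⟨p, hp, rfl⟩ := List.mem_map.1 hy
  exact EE_w (h p hp)

theorem wd_short {n : ℕ} (L : List ((Fin n ⊕ Fin n) × (Fin n ⊕ Fin n)))
    (h : L.length < 2 * n) : str (wd L) = 0 := by
  have : ∃ i, i ∉ (L.map Prod.fst).toFinset := by
    by_contra! hc
    have h1 : (L.map Prod.fst).toFinset = Finset.univ := by
      ext i; simpa using hc i
    have h2 := List.toFinset_card_le (L.map Prod.fst)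
    rw [h1] at h2
    simp at h2
    omega
  obtain ⟨i, hi⟩ := this
  refine wd_zero1 i L ?_
  rintro p hp rfl
  exact hi (List.mem_toFinset.2 (List.mem_map_of_mem hp))

theorem str_add' {n : ℕ} (X Y : EndL n) : str (X + Y) = str X + str Y := by
  simp [str_eq, mul_add]

theorem str_smul' {n : ℕ} (c : ℂ) (X : EndL n) : str (c • X) = c * str X := by
  simp [str_eq]

theorem str_sub' {n : ℕ} (X Y : EndL n) : str (X - Y) = str X - str Y := by
  simp [str_eq, mul_sub]

theorem str_sum' {n : ℕ} {ι : Type*} (s : Finset ι) (f : ι → EndL n) :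
    str (∑ i ∈ s, f i) = ∑ i ∈ s, str (f i) := by
  simp [str_eq, Finset.mul_sum]

theorem swap1 {n : ℕ} (L1 L2 : List ((Fin n ⊕ Fin n) × (Fin n ⊕ Fin n))) (i j k l)
    (h : L1.length + L2.length + 2 ≤ 2 * n) :
    str (wd (L1 ++ (k, j) :: (i, l) :: L2)) = - str (wd (L1 ++ (i, j) :: (k, l) :: L2)) := by
  rw [eq_neg_iff_add_eq_zero, ← str_add']
  have key : wd (L1 ++ (k, j) :: (i, l) :: L2) + wd (L1 ++ (i, j) :: (k, l) :: L2)
      = (if j = i then (1 : ℂ) else 0) • wd (L1 ++ (k, l) :: L2)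
        + (if j = k then (1 : ℂ) else 0) • wd (L1 ++ (i, l) :: L2) := by
    simp only [wd_app, wd_cons]
    rw [← mul_add, ← mul_assoc, ← mul_assoc, ← add_mul, EE_EE1]
    simp only [add_mul, mul_add, smul_mul_assoc, mul_smul_comm]
  rw [key, str_add', str_smul', str_smul', wd_short, wd_short] <;> simp <;> omega

theorem swap2 {n : ℕ} (L1 L2 : List ((Fin n ⊕ Fin n) × (Fin n ⊕ Fin n))) (i j k l)
    (h : L1.length + L2.length + 2 ≤ 2 * n) :
    str (wd (L1 ++ (i, l) :: (k, j) :: L2)) = - str (wd (L1 ++ (i, j) :: (k, l) :: L2)) := by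
  rw [eq_neg_iff_add_eq_zero, ← str_add']
  have key : wd (L1 ++ (i, l) :: (k, j) :: L2) + wd (L1 ++ (i, j) :: (k, l) :: L2)
      = (if l = k then (1 : ℂ) else 0) • wd (L1 ++ (i, j) :: L2)
        + (if j = k then (1 : ℂ) else 0) • wd (L1 ++ (i, l) :: L2) := by
    simp only [wd_app, wd_cons]
    rw [← mul_add, ← mul_assoc, ← mul_assoc, ← add_mul, EE_EE2]
    simp only [add_mul, mul_add, smul_mul_assoc, mul_smul_comm]
  rw [key, str_add', str_smul', str_smul', wd_short, wd_short] <;> simp <;> omega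

theorem ofFn_split {α : Type*} {m : ℕ} (f : Fin (m + 1) → α) (k : Fin m) :
    List.ofFn f = (List.ofFn f).take k ++ f k.castSucc :: f k.succ :: (List.ofFn f).drop (k + 2) := by
  conv_lhs => rw [← List.take_append_drop k (List.ofFn f)]
  congr 1
  rw [List.drop_eq_getElem_cons (by simp), List.drop_eq_getElem_cons (by simp)]
  simp only [List.getElem_ofFn]
  rfl

theorem ofFn_take_congr {α : Type*} {m : ℕ} (f g : Fin m → α) (k : ℕ)
    (h : ∀ i : Fin m, i < k → f i = g i) : (List.ofFn f).take k = (List.ofFn g).take k := by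
  apply List.ext_getElem
  · simp
  · intro i h1 h2
    simp at h1 h2 ⊢
    exact h _ (by simpa using h1.1)

theorem ofFn_drop_congr {α : Type*} {m : ℕ} (f g : Fin m → α) (k : ℕ)
    (h : ∀ i : Fin m, k ≤ i → f i = g i) : (List.ofFn f).drop k = (List.ofFn g).drop k := by
  apply List.ext_getElem
  · simp
  · intro i h1 h2
    simp at h1 h2 ⊢
    exact h _ (by simp)

def GG {n m : ℕ} (i j : Fin m → Fin n ⊕ Fin n) : ℂ :=
  str (wd (List.ofFn fun k => (i k, j k)))

theorem GG_swap1 {n m : ℕ} (hm : m + 1 = 2 * n) (i j : Fin (m + 1) → Fin n ⊕ Fin n) (k : Fin m) :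
    GG (i ∘ Equiv.swap k.castSucc k.succ) j = - GG i j := by
  have hk := k.2
  have hne : k.castSucc ≠ k.succ := Fin.castSucc_lt_succ.ne
  unfold GG
  rw [ofFn_split _ k, ofFn_split (fun k => (i k, j k)) k]
  simp only [Function.comp, Equiv.swap_apply_left, Equiv.swap_apply_right]
  rw [ofFn_take_congr _ (fun k => (i k, j k)), ofFn_drop_congr _ (fun k => (i k, j k)), swap1]
  · simp; omega
  · intro l hl
    rw [Equiv.swap_apply_of_ne_of_ne] <;> rintro rfl <;> simp at hl
  · intro l hl
    rw [Equiv.swap_apply_of_ne_of_ne] <;> rintro rfl <;> simp at hl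

theorem GG_swap2 {n m : ℕ} (hm : m + 1 = 2 * n) (i j : Fin (m + 1) → Fin n ⊕ Fin n) (k : Fin m) :
    GG i (j ∘ Equiv.swap k.castSucc k.succ) = - GG i j := by
  have hk := k.2
  unfold GG
  rw [ofFn_split _ k, ofFn_split (fun k => (i k, j k)) k]
  simp only [Function.comp, Equiv.swap_apply_left, Equiv.swap_apply_right]
  rw [ofFn_take_congr _ (fun k => (i k, j k)), ofFn_drop_congr _ (fun k => (i k, j k)), swap2]
  · simp; omega
  · intro l hl
    rw [Equiv.swap_apply_of_ne_of_ne] <;> rintro rfl <;> simp at hl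
  · intro l hl
    rw [Equiv.swap_apply_of_ne_of_ne] <;> rintro rfl <;> simp at hl

theorem perm_sign {X : Type*} {m : ℕ} (F : (Fin m → X) → ℂ)
    (h : ∀ (m' : ℕ) (hm : m = m' + 1) (k : Fin m') (i : Fin m → X),
      F (i ∘ Equiv.swap (Fin.cast hm.symm k.castSucc) (Fin.cast hm.symm k.succ)) = - F i)
    (σ : Equiv.Perm (Fin m)) (i : Fin m → X) :
    F (i ∘ σ) = (Equiv.Perm.sign σ : ℤ) * F i := by
  cases m with
  | zero => 
    have : σ = 1 := Subsingleton.elim _ _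
    subst this; simp
  | succ m =>
    have hσ : σ ∈ Submonoid.closure
      (Set.range fun i : Fin m ↦ Equiv.swap i.castSucc i.succ) := by
      rw [Equiv.Perm.mclosure_swap_castSucc_succ]; trivial
    induction hσ using Submonoid.closure_induction generalizing i with
    | mem x hx =>
      obtain ⟨k, rfl⟩ := hx
      have := h m rfl k i
      simp only [Fin.cast_eq_self] at this
      simp only []
      rw [this, Equiv.Perm.sign_swap (Fin.castSucc_lt_succ.ne)]
      simp
    | one => simp
    | mul x y _ _ hx hy =>
      have := hy (i ∘ x)
      rw [Equiv.Perm.coe_mul, ← Function.comp_assoc, this, hx]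
      simp
      ring

theorem GG_perm {n : ℕ} (i j : Fin (2 * n) → Fin n ⊕ Fin n) (σ τ : Equiv.Perm (Fin (2 * n))) :
    GG (i ∘ σ) (j ∘ τ) = (Equiv.Perm.sign σ : ℤ) * ((Equiv.Perm.sign τ : ℤ) * GG i j) := by
  rw [perm_sign (fun i => GG i (j ∘ τ)), perm_sign (fun j => GG i j)]
  · intro m' hm k i'
    generalize_proofs at *
    revert i i'  j σ τ
    generalize hN : 2 * n = N at *
    subst hm
    intros
    exact GG_swap2 hN.symm _ _ _
  · intro m' hm k i'
    revert i i'  j σ τ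
    generalize hN : 2 * n = N at *
    subst hm
    intros
    exact GG_swap1 hN.symm _ _ _

theorem sum_inj {X : Type*} [Fintype X] [DecidableEq X] {m : ℕ} (E : Fin m ≃ X)
    (F : (Fin m → X) → ℂ) (h : ∀ i, ¬ Function.Surjective i → F i = 0) :
    ∑ i, F i = ∑ σ : Equiv.Perm (Fin m), F (E ∘ σ) := by
  symm
  refine Finset.sum_of_injOn (fun σ => E ∘ σ) ?_ ?_ ?_ ?_
  · intro σ _ τ _ hst
    ext1 k
    exact E.injective (congrFun hst k)
  · simp
  · intro i _ hi
    apply h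
    intro hs
    apply hi
    have hb : Function.Bijective i :=
      (Fintype.bijective_iff_surjective_and_card i).2 ⟨hs, Fintype.card_congr E⟩
    refine ⟨(Equiv.ofBijective i hb).trans E.symm, by simp, ?_⟩
    ext k; simp
  · simp

theorem GG_nsurj1 {n m : ℕ} (i j : Fin m → Fin n ⊕ Fin n) (h : ¬ Function.Surjective i) :
    GG i j = 0 := by
  simp only [Function.Surjective, not_forall, not_exists] at h
  obtain ⟨b, hb⟩ := h
  apply wd_zero1 b
  intro p hp
  obtain ⟨k, rfl⟩ := (List.mem_ofFn' _ _).1 hp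
  exact hb k

theorem GG_nsurj2 {n m : ℕ} (i j : Fin m → Fin n ⊕ Fin n) (h : ¬ Function.Surjective j) :
    GG i j = 0 := by
  simp only [Function.Surjective, not_forall, not_exists] at h
  obtain ⟨b, hb⟩ := h
  apply wd_zero2 b
  intro p hp
  obtain ⟨k, rfl⟩ := (List.mem_ofFn' _ _).1 hp
  exact hb k

def DD {n : ℕ} (M : Matrix (Fin n ⊕ Fin n) (Fin n ⊕ Fin n) ℂ) : EndL n :=
  ∑ p : (Fin n ⊕ Fin n) × (Fin n ⊕ Fin n), M p.1 p.2 • EE p.1 p.2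

theorem str_DD_pow {n : ℕ} (M : Matrix (Fin n ⊕ Fin n) (Fin n ⊕ Fin n) ℂ) (m : ℕ) :
    str (DD M ^ m) = ∑ i : Fin m → Fin n ⊕ Fin n, ∑ j : Fin m → Fin n ⊕ Fin n,
      (∏ k, M (i k) (j k)) * GG i j := by
  rw [← MultilinearMap.mkPiAlgebraFin_apply_const (R := ℂ)]
  unfold DD
  rw [MultilinearMap.map_sum, str_sum', ← Fintype.sum_prod_type']
  refine Fintype.sum_equiv (Equiv.arrowProdEquivProdArrow _ _ _) _ _ ?_
  intro p
  rw [MultilinearMap.map_smul_univ, str_smul']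
  simp [GG, wd, List.map_ofFn, Function.comp_def]

theorem sum_det {N : ℕ} (M : Matrix (Fin N) (Fin N) ℂ) :
    ∑ σ : Equiv.Perm (Fin N), ∑ τ : Equiv.Perm (Fin N),
      (∏ k, M (σ k) (τ k)) * (((Equiv.Perm.sign σ : ℤ) : ℂ) * ((Equiv.Perm.sign τ : ℤ) : ℂ))
      = (N.factorial : ℂ) * M.det := by
  rw [Finset.sum_comm]
  have : ∀ τ : Equiv.Perm (Fin N), ∑ σ : Equiv.Perm (Fin N),
      (∏ k, M (σ k) (τ k)) * (((Equiv.Perm.sign σ : ℤ) : ℂ) * ((Equiv.Perm.sign τ : ℤ) : ℂ))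
      = M.det := by
    intro τ
    have h1 := Matrix.det_permute' τ M
    rw [Matrix.det_apply'] at h1
    have h2 : (((Equiv.Perm.sign τ : ℤ) : ℂ) * ((Equiv.Perm.sign τ : ℤ) : ℂ)) = 1 := by
      rcases Int.units_eq_one_or (Equiv.Perm.sign τ) with h | h <;> simp [h]
    calc _ = ((Equiv.Perm.sign τ : ℤ) : ℂ) * ∑ σ : Equiv.Perm (Fin N),
          ((Equiv.Perm.sign σ : ℤ) : ℂ) * ∏ k, (M.submatrix id τ) (σ k) k := by
            rw [Finset.mul_sum]
            refine Finset.sum_congr rfl fun σ _ => ?_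
            simp; ring
      _ = _ := by rw [h1, ← mul_assoc, h2, one_mul]
  simp [this, Fintype.card_perm]

def QQ {n : ℕ} (i : Fin n ⊕ Fin n) : EndL n := cv i * wv i

theorem PQ {n : ℕ} (i : Fin n ⊕ Fin n) : EE i i = 1 - QQ i := by
  have := cw i i
  simp only [if_true] at this
  rw [EE, QQ, ← this]; abel

theorem QQ_w {n : ℕ} {i k : Fin n ⊕ Fin n} (h : i ≠ k) : QQ i * wv k = wv k * QQ i := by
  have h1 := EE_w (i := i) h
  rw [PQ] at h1
  simpa [sub_mul, mul_sub] using h1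

theorem QQ_c {n : ℕ} {i k : Fin n ⊕ Fin n} (h : i ≠ k) : QQ i * cv k = cv k * QQ i := by
  have h1 := EE_c (j := i) h
  rw [PQ] at h1
  simpa [sub_mul, mul_sub] using h1

theorem PtoQ {n : ℕ} (L2 : List (Fin n ⊕ Fin n)) : ∀ L1 : List (Fin n ⊕ Fin n),
    (L1 ++ L2).Nodup →
    str ((L1.map QQ).prod * (L2.map fun i => EE i i).prod)
      = (-1) ^ L2.length * str (((L1 ++ L2).map QQ).prod) := by
  induction L2 with
  | nil => intro L1 _; simp
  | cons x L2 ih =>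
    intro L1 h
    have h' : ((L1 ++ [x]) ++ L2).Nodup := by simpa using h
    have := ih _ h'
    have e1 : (L1.map QQ).prod * ((x :: L2).map fun i => EE i i).prod
        = (L1.map QQ).prod * (L2.map fun i => EE i i).prod
          - (((L1 ++ [x]).map QQ).prod * (L2.map fun i => EE i i).prod : EndL n) := by
      simp [PQ x, sub_mul, mul_sub, mul_assoc]
    rw [e1, str_sub', this, str_zero_w x]
    · simp [pow_succ]
    · have hx1 : x ∉ L1 := by
        rw [List.nodup_append] at h
        intro hx; exact h.2.2 x hx x (by simp) rfl
      have hx2 : x ∉ L2 := by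
        rw [List.nodup_append] at h
        exact (List.nodup_cons.1 h.2.1).1
      have c1 := list_comm (L1.map QQ) (wv x : EndL n) (by
        intro y hy
        obtain ⟨p, hp, rfl⟩ := List.mem_map.1 hy
        exact QQ_w (by rintro rfl; exact hx1 hp))
      have c2 := list_comm (L2.map fun i => EE i i) (wv x : EndL n) (by
        intro y hy
        obtain ⟨p, hp, rfl⟩ := List.mem_map.1 hy
        exact EE_w (by rintro rfl; exact hx2 hp))
      rw [mul_assoc, c2, ← mul_assoc, c1, mul_assoc]

theorem QQ_self_w {n : ℕ} (i : Fin n ⊕ Fin n) : (QQ i * wv i : EndL n) = 0 := by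
  have h : (wv i * wv i : EndL n) = 0 := by
    have h1 := ww i i
    rw [eq_neg_iff_add_eq_zero, ← two_smul ℂ] at h1
    exact (smul_eq_zero.1 h1).resolve_left two_ne_zero
  rw [QQ, mul_assoc, h, mul_zero]

theorem Qprod_w {n : ℕ} (L : List (Fin n ⊕ Fin n)) (i) (hi : i ∈ L) :
    ((L.map QQ).prod * wv i : EndL n) = 0 := by
  induction L with
  | nil => simp at hi
  | cons x L ih =>
    by_cases h : i ∈ L
    · simp [mul_assoc, ih h]
    · have hx : i = x := by simpa [h] using hi
      subst hx
      have c1 := list_comm (L.map QQ) (wv i : EndL n) (by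
        intro y hy
        obtain ⟨p, hp, rfl⟩ := List.mem_map.1 hy
        exact QQ_w (by rintro rfl; exact h hp))
      rw [List.map_cons, List.prod_cons, mul_assoc, c1, ← mul_assoc, QQ_self_w, zero_mul]

theorem Qprod_one {n : ℕ} (L : List (Fin n ⊕ Fin n)) :
    ((L.map QQ).prod : EndL n) 1 = 1 := by
  induction L with
  | nil => simp
  | cons x L ih =>
    rw [List.map_cons, List.prod_cons, Module.End.mul_apply, ih]
    change CliffordAlgebra.contractLeft _ (CliffordAlgebra.ι _ (e x) * 1) = _
    rw [CliffordAlgebra.contractLeft_ι_mul]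
    simp [e]

theorem Qprod_ι {n : ℕ} (L : List (Fin n ⊕ Fin n)) (hL : ∀ i, i ∈ L) (v : W n)
    (x : ExteriorAlgebra ℂ (W n)) :
    ((L.map QQ).prod : EndL n) (ExteriorAlgebra.ι ℂ v * x) = 0 := by
  have hv : v = ∑ i, v i • (e i : W n) := by
    ext j; simp [e, Pi.single_apply]
  rw [hv, map_sum, Finset.sum_mul, map_sum]
  refine Finset.sum_eq_zero fun i _ => ?_
  rw [map_smul, smul_mul_assoc, map_smul]
  have := LinearMap.congr_fun (Qprod_w L i (hL i)) x
  change _ • ((L.map QQ).prod * wv i : EndL n) x = 0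
  rw [this]; simp

theorem Qprod_eq {n : ℕ} (L : List (Fin n ⊕ Fin n)) (hL : ∀ i, i ∈ L) :
    ((L.map QQ).prod : EndL n) =
      (ExteriorAlgebra.algebraMapInv (R := ℂ) (M := W n)).toLinearMap.smulRight 1 := by
  refine LinearMap.ext fun x => ?_
  induction x using CliffordAlgebra.left_induction with
  | algebraMap r =>
    rw [Algebra.algebraMap_eq_smul_one, map_smul, map_smul]
    congr 1
    refine (Qprod_one L).trans ?_
    symm
    exact (congrArg (fun c : ℂ => c • (1 : ExteriorAlgebra ℂ (W n)))
      (map_one (ExteriorAlgebra.algebraMapInv (R := ℂ) (M := W n)))).trans (one_smul _ _)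
  | add x y hx hy => rw [map_add, map_add, hx, hy]
  | ι_mul x v _ =>
    refine (Qprod_ι L hL v x).trans ?_
    symm
    have h0 : (ExteriorAlgebra.algebraMapInv (R := ℂ) (M := W n)) (ExteriorAlgebra.ι ℂ v * x) = 0 := by
      rw [map_mul]
      simp [ExteriorAlgebra.algebraMapInv]
    exact (congrArg (fun c : ℂ => c • (1 : ExteriorAlgebra ℂ (W n))) h0).trans (zero_smul _ _)

theorem str_Qprod {n : ℕ} (L : List (Fin n ⊕ Fin n)) (hL : ∀ i, i ∈ L) :
    str (L.map QQ).prod = 1 := by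
  have h : epsOp n * (L.map QQ).prod = (L.map QQ).prod := by
    rw [Qprod_eq L hL]
    refine LinearMap.ext fun x => ?_
    change CliffordAlgebra.involute (Q := (0 : QuadraticForm ℂ (W n))) ((ExteriorAlgebra.algebraMapInv x) • 1) = _
    rw [map_smul, map_one]; rfl
  rw [str_eq, h, Qprod_eq L hL, LinearMap.trace_smulRight]
  exact map_one (ExteriorAlgebra.algebraMapInv (R := ℂ) (M := W n))

theorem GG_base {n : ℕ} (E : Fin (2 * n) ≃ Fin n ⊕ Fin n) : GG E E = 1 := by
  have h := PtoQ (List.ofFn E) [] (by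
    simpa using List.nodup_ofFn.2 E.injective)
  rw [List.nil_append, str_Qprod] at h
  · simp at h
    rw [GG, wd, List.map_ofFn]
    simpa [List.map_ofFn, Function.comp_def] using h
  · intro i
    rw [List.mem_ofFn']
    exact E.surjective i

theorem str_DD_lt {n : ℕ} (M : Matrix (Fin n ⊕ Fin n) (Fin n ⊕ Fin n) ℂ) (m : ℕ) (h : m < 2 * n) :
    str (DD M ^ m) = 0 := by
  rw [str_DD_pow]
  refine Finset.sum_eq_zero fun i _ => Finset.sum_eq_zero fun j _ => ?_
  rw [GG, wd_short _ (by simpa using h), mul_zero]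

theorem str_DD_top {n : ℕ} (M : Matrix (Fin n ⊕ Fin n) (Fin n ⊕ Fin n) ℂ) :
    str (DD M ^ (2 * n)) = ((2 * n).factorial : ℂ) * M.det := by
  let E : Fin (2 * n) ≃ Fin n ⊕ Fin n := (finCongr (two_mul n)).trans finSumFinEquiv.symm
  rw [str_DD_pow, sum_inj E]
  · rw [← Matrix.det_submatrix_equiv_self E, ← sum_det]
    refine Finset.sum_congr rfl fun σ _ => ?_
    rw [sum_inj E]
    · refine Finset.sum_congr rfl fun τ _ => ?_
      rw [GG_perm, GG_base]
      simp
    · intro j hj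
      rw [GG_nsurj2 _ _ hj, mul_zero]
  · intro i hi
    refine Finset.sum_eq_zero fun j _ => ?_
    rw [GG_nsurj1 _ _ hi, mul_zero]

theorem det_block {n : ℕ} (B C : Matrix (Fin n) (Fin n) ℂ) :
    (Matrix.fromBlocks 0 B C 0).det = (-1) ^ n * (B.det * C.det) := by
  have h1 : (Matrix.fromBlocks 0 1 1 0 : Matrix (Fin n ⊕ Fin n) (Fin n ⊕ Fin n) ℂ).det
      = (-1) ^ n := by
    have h : (Matrix.fromBlocks 0 1 1 0 : Matrix (Fin n ⊕ Fin n) (Fin n ⊕ Fin n) ℂ)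
      * Matrix.fromBlocks 1 0 1 1 = Matrix.fromBlocks 1 1 1 0 := by
      simp [Matrix.fromBlocks_multiply]
    have h2 := congrArg Matrix.det h
    rw [Matrix.det_mul, Matrix.det_fromBlocks_zero₁₂, Matrix.det_fromBlocks_one₁₁] at h2
    simpa [Matrix.det_neg] using h2
  have h : (Matrix.fromBlocks 0 B C 0) = Matrix.fromBlocks B 0 0 C * Matrix.fromBlocks 0 1 1 0 := by
    simp [Matrix.fromBlocks_multiply]
  rw [h, Matrix.det_mul, h1, Matrix.det_fromBlocks_zero₁₂]
  ring

theorem cw_neg {n : ℕ} {i j : Fin n ⊕ Fin n} (h : i ≠ j) :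
    (contr i ∘ₗ wedge j : EndL n) = - EE j i := by
  have := cw i j
  rw [if_neg h, add_eq_zero_iff_eq_neg] at this
  exact this

/-- Supertraces of powers of
`B = −∑_{μ,l} (A_{μl} ι_{ē_μ}∘(e_l ∧ ·) + conj A_{μl} ι_{e_μ}∘(ē_l ∧ ·))` for a
symmetric matrix `A`: they vanish for `1 ≤ m < 2n`, and
`str(B^{2n}) = (−1)ⁿ (2n)! |det A|²`. -/
theorem supertrace_powers {n : ℕ} (A : Matrix (Fin n) (Fin n) ℂ) (hA : A.IsSymm)
    (B : ExteriorAlgebra ℂ (W n) →ₗ[ℂ] ExteriorAlgebra ℂ (W n))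
    (hB : B = -∑ μ : Fin n, ∑ l : Fin n,
      (A μ l • (contr (Sum.inr μ) ∘ₗ wedge (Sum.inl l)) +
        (starRingEnd ℂ) (A μ l) • (contr (Sum.inl μ) ∘ₗ wedge (Sum.inr l)))) :
    (∀ m : ℕ, 1 ≤ m → m < 2 * n → str (B ^ m) = 0) ∧
    str (B ^ (2 * n)) = (-1 : ℂ) ^ n * ((2 * n).factorial : ℂ) * (‖A.det‖ : ℂ) ^ 2 := by
  have hD : B = DD (Matrix.fromBlocks 0 A.transpose (A.transpose.map (starRingEnd ℂ)) 0) := by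
    rw [hB, DD, Fintype.sum_prod_type]
    simp only [Fintype.sum_sum_type, Matrix.fromBlocks_apply₁₁, Matrix.fromBlocks_apply₁₂,
      Matrix.fromBlocks_apply₂₁, Matrix.fromBlocks_apply₂₂, Matrix.zero_apply, zero_smul,
      Finset.sum_const_zero, zero_add, add_zero, Matrix.transpose_apply, Matrix.map_apply]
    rw [Finset.sum_comm, ← Finset.sum_add_distrib, ← Finset.sum_neg_distrib]
    refine Finset.sum_congr rfl fun l _ => ?_
    rw [← Finset.sum_add_distrib, ← Finset.sum_neg_distrib]
    refine Finset.sum_congr rfl fun μ _ => ?_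
    rw [cw_neg (by simp), cw_neg (by simp)]
    simp [add_comm]
  rw [hD]
  refine ⟨fun m _ hm => str_DD_lt _ m hm, ?_⟩
  rw [str_DD_top, det_block, Matrix.det_transpose]
  have h1 : (A.transpose.map (starRingEnd ℂ)).det = (starRingEnd ℂ) A.det := by
    rw [← Matrix.det_transpose A]
    exact (RingHom.map_det (starRingEnd ℂ) A.transpose).symm
  rw [h1, Complex.mul_conj, Complex.normSq_eq_norm_sq]
  push_cast
  ring
end
end

section
/- Let W be a complex vector space of dimension 2n with basis e₁,…,eₙ, ē₁,…,ēₙ, and define endomorphisms of the exterior algebra Λ(W): c_i = (e_i ∧ ·) − ι_{e_i}, ĉ_i = (e_i ∧ ·) + ι_{e_i}, c̄_i = (ē_i ∧ ·) − ι_{ē_i}, ĉ̄_i = (ē_i ∧ ·) + ι_{ē_i}, where ι denotes contraction against the corresponding dual basis vector. Then the supertrace str(∏_{i=1}ⁿ (c_i ∘ ĉ_i ∘ c̄_i ∘ ĉ̄_i)) = 4ⁿ, where str(T) = ∑_{k=0}^{2n} (−1)^k tr(T|_{Λ^k(W)}). -/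
noncomputable section

/-- The Clifford operator `c_i = e_i ∧ · − ι_{e_i}`. -/
def c {n : ℕ} (i : Fin n ⊕ Fin n) :
    ExteriorAlgebra ℂ (W n) →ₗ[ℂ] ExteriorAlgebra ℂ (W n) :=
  wedge i - contr i

/-- The Clifford operator `ĉ_i = e_i ∧ · + ι_{e_i}`. -/
def chat {n : ℕ} (i : Fin n ⊕ Fin n) :
    ExteriorAlgebra ℂ (W n) →ₗ[ℂ] ExteriorAlgebra ℂ (W n) :=
  wedge i + contr i

lemma aux_wedge {n : ℕ} (i : Fin n ⊕ Fin n) (x : ExteriorAlgebra ℂ (W n)) :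
    wedge i x = ExteriorAlgebra.ι ℂ (e i) * x := rfl

lemma aux_contr_ι_mul {n : ℕ} (i : Fin n ⊕ Fin n) (v : W n) (x : ExteriorAlgebra ℂ (W n)) :
    contr i (ExteriorAlgebra.ι ℂ v * x) = v i • x - ExteriorAlgebra.ι ℂ v * contr i x :=
  CliffordAlgebra.contractLeft_ι_mul _ _ _

lemma aux_contr_contr {n : ℕ} (i : Fin n ⊕ Fin n) (x : ExteriorAlgebra ℂ (W n)) :
    contr i (contr i x) = 0 :=
  CliffordAlgebra.contractLeft_contractLeft _ _

lemma aux_anti {n : ℕ} (u v : W n) (x : ExteriorAlgebra ℂ (W n)) :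
    ExteriorAlgebra.ι ℂ u * (ExteriorAlgebra.ι ℂ v * x) =
      - (ExteriorAlgebra.ι ℂ v * (ExteriorAlgebra.ι ℂ u * x)) := by
  have h := ExteriorAlgebra.ι_add_mul_swap (R := ℂ) u v
  rw [← mul_assoc, ← mul_assoc, eq_neg_iff_add_eq_zero, ← add_mul, h, zero_mul]

lemma aux_sq {n : ℕ} (u : W n) (x : ExteriorAlgebra ℂ (W n)) :
    ExteriorAlgebra.ι ℂ u * (ExteriorAlgebra.ι ℂ u * x) = 0 := by
  rw [← mul_assoc, ExteriorAlgebra.ι_sq_zero, zero_mul]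

lemma aux_e_self {n : ℕ} (i : Fin n ⊕ Fin n) : (e i : W n) i = 1 := by simp [e]

lemma aux_cc {n : ℕ} (i : Fin n ⊕ Fin n) (x : ExteriorAlgebra ℂ (W n)) :
    c i (chat i x) = (2 : ℂ) • (ExteriorAlgebra.ι ℂ (e i) * contr i x) - x := by
  simp only [c, chat, LinearMap.add_apply, LinearMap.sub_apply, aux_wedge, map_add,
    aux_sq, aux_contr_ι_mul, aux_contr_contr, aux_e_self, one_smul, two_smul]
  abel

/-- The algebra endomorphism of `Λ(W)` induced by a diagonal map. -/
def auxDiag {n : ℕ} (d : Fin n ⊕ Fin n → ℂ) :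
    ExteriorAlgebra ℂ (W n) →ₐ[ℂ] ExteriorAlgebra ℂ (W n) :=
  ExteriorAlgebra.map (LinearMap.mulLeft ℂ d)

lemma auxDiag_mul {n : ℕ} (d d' : Fin n ⊕ Fin n → ℂ) :
    auxDiag (d * d') = (auxDiag d).comp (auxDiag d') := by
  simp only [auxDiag, ExteriorAlgebra.map_comp_map, LinearMap.mulLeft_mul]

lemma auxDiag_one {n : ℕ} : auxDiag (1 : Fin n ⊕ Fin n → ℂ) = AlgHom.id ℂ _ := by
  simp only [auxDiag, LinearMap.mulLeft_one, ExteriorAlgebra.map_id]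

/-- `auxDiag` as a monoid hom. -/
def auxHom (n : ℕ) : (Fin n ⊕ Fin n → ℂ) →* Module.End ℂ (ExteriorAlgebra ℂ (W n)) where
  toFun d := (auxDiag d).toLinearMap
  map_one' := by rw [auxDiag_one]; rfl
  map_mul' d d' := by rw [auxDiag_mul]; rfl

lemma aux_cc_diag {n : ℕ} (i : Fin n ⊕ Fin n) (x : ExteriorAlgebra ℂ (W n)) :
    c i (chat i x) = - auxDiag (Function.update 1 i (-1)) x := by
  induction x using CliffordAlgebra.left_induction with
  | algebraMap r =>
    rw [aux_cc, AlgHom.commutes]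
    have : contr i (algebraMap ℂ (CliffordAlgebra (0 : QuadraticForm ℂ (W n))) r) = 0 :=
      CliffordAlgebra.contractLeft_algebraMap _ _ _
    rw [this]; simp
  | add x y hx hy => rw [map_add, map_add, hx, hy, map_add, neg_add]
  | ι_mul x v hx =>
    change c i (chat i (ExteriorAlgebra.ι ℂ v * x)) =
      - auxDiag (Function.update 1 i (-1)) (ExteriorAlgebra.ι ℂ v * x)
    have h1 : auxDiag (Function.update 1 i (-1)) (ExteriorAlgebra.ι ℂ v) =
        ExteriorAlgebra.ι ℂ v - (2 * v i) • ExteriorAlgebra.ι ℂ (e i) := by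
      rw [auxDiag, ExteriorAlgebra.map_apply_ι, ← map_smul, ← map_sub]
      congr 1
      funext j
      by_cases h : j = i
      · subst h; simp [e]; ring
      · simp [e, h]
    rw [map_mul (auxDiag _), h1, ← mul_neg, ← hx, aux_cc, aux_cc, aux_contr_ι_mul]
    simp only [mul_sub, sub_mul, smul_mul_assoc, mul_smul_comm, aux_sq, smul_zero, smul_sub]
    rw [aux_anti (e i) v, mul_smul]
    module

theorem aux_involute {n : ℕ} :
    (List.ofFn fun i : Fin n =>
        c (Sum.inl i) ∘ₗ chat (Sum.inl i) ∘ₗ c (Sum.inr i) ∘ₗ chat (Sum.inr i)).prod =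
      (CliffordAlgebra.involute (Q := (0 : QuadraticForm ℂ (W n)))).toLinearMap := by
  have h : (fun i : Fin n =>
        c (Sum.inl i) ∘ₗ chat (Sum.inl i) ∘ₗ c (Sum.inr i) ∘ₗ chat (Sum.inr i)) =
      (auxHom n) ∘ fun i : Fin n => (Function.update (1 : Fin n ⊕ Fin n → ℂ) (Sum.inl i) (-1) *
        Function.update (1 : Fin n ⊕ Fin n → ℂ) (Sum.inr i) (-1) : Fin n ⊕ Fin n → ℂ) := by
    funext i
    refine LinearMap.ext fun x => ?_
    simp only [LinearMap.comp_apply, aux_cc_diag, map_neg, neg_neg, Function.comp_apply, map_mul]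
    rfl
  rw [h, ← List.map_ofFn, ← map_list_prod, List.prod_ofFn]
  have h2 : (∏ i : Fin n, (Function.update (1 : Fin n ⊕ Fin n → ℂ) (Sum.inl i) (-1) *
        Function.update (1 : Fin n ⊕ Fin n → ℂ) (Sum.inr i) (-1) : Fin n ⊕ Fin n → ℂ)) = -1 := by
    funext j
    rw [Finset.prod_apply]
    rcases j with j | j <;>
    simp [Function.update_apply]
  rw [h2]
  change (auxDiag (-1)).toLinearMap = _
  congr 1
  refine ExteriorAlgebra.hom_ext (LinearMap.ext fun v => ?_)
  change auxDiag (-1) (ExteriorAlgebra.ι ℂ v) = CliffordAlgebra.involute (CliffordAlgebra.ι _ v)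
  rw [CliffordAlgebra.involute_ι, auxDiag, ExteriorAlgebra.map_apply_ι]
  simp

/-- `str (∏_{i=1}ⁿ c_i ∘ ĉ_i ∘ c̄_i ∘ ĉ̄_i) = 4ⁿ`. -/
theorem supertrace_clifford_product (n : ℕ) :
    str ((List.ofFn fun i : Fin n =>
        c (Sum.inl i) ∘ₗ chat (Sum.inl i) ∘ₗ c (Sum.inr i) ∘ₗ chat (Sum.inr i)).prod) =
      (4 : ℂ) ^ n := by
  rw [aux_involute, str]
  have h : (CliffordAlgebra.involute (Q := (0 : QuadraticForm ℂ (W n)))).toLinearMap ∘ₗ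
      (CliffordAlgebra.involute (Q := (0 : QuadraticForm ℂ (W n)))).toLinearMap =
      (1 : Module.End ℂ (ExteriorAlgebra ℂ (W n))) :=
    LinearMap.ext fun x => CliffordAlgebra.involute_involute x
  let b := ((Pi.basisFun ℂ (Fin n ⊕ Fin n)).reindex (toLex)).ExteriorAlgebra
  rw [h]
  have := Module.Finite.of_basis b
  have := Module.Free.of_basis b
  rw [LinearMap.trace_one, Module.finrank_eq_card_basis b]
  simp only [Fintype.card_finset, Fintype.card_lex, Fintype.card_sum, Fintype.card_fin]
  push_cast
  rw [← two_mul, pow_mul]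
  norm_num
end
end
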